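/- Fix p > 1. Let λ be a Borel probability measure on ℝ^d with bounded convex support, absolutely continuous with respect to Lebesgue measure, with density bounded above and below by strictly positive constants, and let Y ⊆ ℝ^d be compact. Let θ be an exponent with θ ∈ (0, (p−1)²/(p(p+1))) if 1 < p < 2 and θ = 1/(6(p−1)) if p ≥ 2. Then there exists a constant C = C(λ, Y, p, θ) < ∞ such that for all Borel probability measures μ and ν supported on Y, ‖T_μ − T_ν‖_{L²(λ)} ≤ C · W₁(μ,ν)^θ, where T_μ (resp. T_ν) denotes the λ-a.e. unique optimal transport map attaining W_p(λ,μ) (resp. W_p(λ,ν)) with respect to the ℓ_p metric on ℝ^d, and ‖T_μ − T_ν‖_{L²(λ)} := (∫ ‖T_μ(x) − T_ν(x)‖_p² dλ(x))^{1/2}. -/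

import Mathlib

open MeasureTheory ProbabilityTheory
open scoped ENNReal

noncomputable section

abbrev Vec (n : ℕ) : Type := Fin n → ℝ

/-- ℓ_p distance on ℝ^n. -/
def lpDist (p : ℝ) {n : ℕ} (x y : Vec n) : ℝ := (∑ i, |x i - y i| ^ p) ^ (1 / p)

/-- product metric d_p on ℝ^{d₁} × ℝ^{d₂}. -/
def prodDist (p : ℝ) {n m : ℕ} (x y : Vec n × Vec m) : ℝ :=
  (lpDist p x.1 y.1 ^ p + lpDist p x.2 y.2 ^ p) ^ (1 / p)

/-- γ is a coupling of α and β. -/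
def IsCoupling {E : Type*} [MeasurableSpace E] (γ : Measure (E × E)) (α β : Measure E) : Prop :=
  IsProbabilityMeasure γ ∧ γ.map Prod.fst = α ∧ γ.map Prod.snd = β

/-- p-Wasserstein distance (p < ∞) w.r.t. a cost/metric c. -/
def Wp {E : Type*} [MeasurableSpace E] (p : ℝ) (c : E → E → ℝ) (α β : Measure E) : ℝ :=
  sInf ((fun γ : Measure (E × E) => (∫ z, c z.1 z.2 ^ p ∂γ) ^ (1 / p)) '' {γ | IsCoupling γ α β})

/-- ∞-Wasserstein distance w.r.t. a cost/metric c. -/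
def Winf {E : Type*} [MeasurableSpace E] (c : E → E → ℝ) (α β : Measure E) : ℝ :=
  sInf ((fun γ : Measure (E × E) => essSup (fun z => c z.1 z.2) γ) '' {γ | IsCoupling γ α β})

/-- q-Wasserstein distance for q ∈ [1,∞]. -/
def Wq {E : Type*} [MeasurableSpace E] (q : ℝ≥0∞) (c : E → E → ℝ) (α β : Measure E) : ℝ :=
  if q = ∞ then Winf c α β else Wp q.toReal c α β

/-- μ is a Borel probability measure concentrated on X. -/
def ProbOn {E : Type*} [MeasurableSpace E] (μ : Measure E) (X : Set E) : Prop :=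
  IsProbabilityMeasure μ ∧ μ Xᶜ = 0

/-- ρ is absolutely continuous with Lebesgue density bounded above and below by strictly
positive constants on X, and vanishing off X. -/
def NiceDensityOn {E : Type*} [MeasureSpace E] (ρ : Measure E) (X : Set E) : Prop :=
  ∃ (f : E → ℝ≥0∞) (c₁ c₂ : ℝ≥0∞), 0 < c₁ ∧ c₂ < ∞ ∧ ρ = volume.withDensity f ∧
    (∀ x ∈ X, c₁ ≤ f x ∧ f x ≤ c₂) ∧ (∀ x ∉ X, f x = 0)

/-- T is an optimal transport map from α to β for W_p w.r.t. cost c. -/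
def IsOptMap {E : Type*} [MeasurableSpace E] (p : ℝ) (c : E → E → ℝ) (α β : Measure E)
    (T : E → E) : Prop :=
  Measurable T ∧ α.map T = β ∧ (∫ x, c x (T x) ^ p ∂α) ^ (1 / p) = Wp p c α β

/-- Π(μ₁, μ₂): couplings of μ₁ and μ₂. -/
def Pi2 {d₁ d₂ : ℕ} (μ₁ : Measure (Vec d₁)) (μ₂ : Measure (Vec d₂)) :
    Set (Measure (Vec d₁ × Vec d₂)) :=
  {π | IsProbabilityMeasure π ∧ π.map Prod.fst = μ₁ ∧ π.map Prod.snd = μ₂}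

/-- S is a shadow of ρ onto Π(μ₁,μ₂) for the p-Wasserstein distance. -/
def IsShadow2 (p : ℝ) {d₁ d₂ : ℕ} (ρ : Measure (Vec d₁ × Vec d₂))
    (μ₁ : Measure (Vec d₁)) (μ₂ : Measure (Vec d₂)) (S : Measure (Vec d₁ × Vec d₂)) : Prop :=
  ∃ (κ₁ : Kernel (Vec d₁) (Vec d₁)) (κ₂ : Kernel (Vec d₂) (Vec d₂)),
    IsMarkovKernel κ₁ ∧ IsMarkovKernel κ₂ ∧
    (∃ γ₁ : Measure (Vec d₁ × Vec d₁),
      (∀ A, MeasurableSet A → γ₁ A = ∫⁻ y, κ₁ y {x | (x, y) ∈ A} ∂(ρ.map Prod.fst)) ∧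
      IsCoupling γ₁ μ₁ (ρ.map Prod.fst) ∧
      (∫ z, lpDist p z.1 z.2 ^ p ∂γ₁) ^ (1 / p) = Wp p (lpDist p) μ₁ (ρ.map Prod.fst)) ∧
    (∃ γ₂ : Measure (Vec d₂ × Vec d₂),
      (∀ A, MeasurableSet A → γ₂ A = ∫⁻ y, κ₂ y {x | (x, y) ∈ A} ∂(ρ.map Prod.snd)) ∧
      IsCoupling γ₂ μ₂ (ρ.map Prod.snd) ∧
      (∫ z, lpDist p z.1 z.2 ^ p ∂γ₂) ^ (1 / p) = Wp p (lpDist p) μ₂ (ρ.map Prod.snd)) ∧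
    (∀ A : Set (Vec d₁ × Vec d₂), MeasurableSet A →
      S A = ∫⁻ y, ((κ₁ y.1).prod (κ₂ y.2)) A ∂ρ)

/-- d_{X,p}: product metric on a K-fold product of Euclidean spaces. -/
def piDist (p : ℝ) {K : ℕ} {d : Fin K → ℕ} (x y : (i : Fin K) → Vec (d i)) : ℝ :=
  (∑ i, lpDist p (x i) (y i) ^ p) ^ (1 / p)

/-- S is a shadow of ρ onto Π(μ₁,…,μ_K) for the p-Wasserstein distance. -/
def IsShadowK (p : ℝ) {K : ℕ} {d : Fin K → ℕ} (ρ : Measure ((i : Fin K) → Vec (d i)))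
    (μ : (i : Fin K) → Measure (Vec (d i))) (S : Measure ((i : Fin K) → Vec (d i))) : Prop :=
  ∃ κ : (i : Fin K) → Kernel (Vec (d i)) (Vec (d i)),
    (∀ i, IsMarkovKernel (κ i)) ∧
    (∀ i, ∃ γ : Measure (Vec (d i) × Vec (d i)),
      (∀ A, MeasurableSet A → γ A = ∫⁻ y, κ i y {x | (x, y) ∈ A} ∂(ρ.map fun z => z i)) ∧
      IsCoupling γ (μ i) (ρ.map fun z => z i) ∧
      (∫ z, lpDist p z.1 z.2 ^ p ∂γ) ^ (1 / p) = Wp p (lpDist p) (μ i) (ρ.map fun z => z i)) ∧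
    (∀ A, MeasurableSet A → S A = ∫⁻ y, Measure.pi (fun i => κ i (y i)) A ∂ρ)


lemma bm1_compact {K L D : Set ℝ} (hK : IsCompact K) (hL : IsCompact L) (nK : K.Nonempty)
    (nL : L.Nonempty) (h : ∀ x ∈ K, ∀ y ∈ L, x + y ∈ D) : volume K + volume L ≤ volume D := by
  set k := sSup K with hk
  set l := sInf L with hl
  have hkK : k ∈ K := hK.sSup_mem nK
  have hlL : l ∈ L := hL.sInf_mem nL
  have h1 : (fun x => x + (-l)) ⁻¹' K ⊆ D := by
    intro x hx
    have := h _ hx _ hlL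
    simpa using this
  have h2 : (fun x => x + (-k)) ⁻¹' L ⊆ D := by
    intro x hx
    have := h _ hkK _ hx
    simpa using this
  have e1 : volume ((fun x => x + (-l)) ⁻¹' K) = volume K := measure_preimage_add_right _ _ _
  have e2 : volume ((fun x => x + (-k)) ⁻¹' L) = volume L := measure_preimage_add_right _ _ _
  rw [← e1, ← e2, ← measure_union₀]
  · exact measure_mono (Set.union_subset h1 h2)
  · exact ((measurable_id.add_const _) hL.measurableSet).nullMeasurableSet
  · refine measure_mono_null (t := {k + l}) ?_ (by simp)
    rintro x ⟨hx1, hx2⟩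
    have a1 : x + (-l) ≤ k := le_csSup hK.bddAbove hx1
    have a2 : l ≤ x + (-k) := csInf_le hL.bddBelow hx2
    simp only [Set.mem_singleton_iff]
    linarith

lemma bm1 {A B C : Set ℝ} (hA : MeasurableSet A) (hB : MeasurableSet B) (nA : A.Nonempty)
    (nB : B.Nonempty) (h : ∀ x ∈ A, ∀ y ∈ B, (x + y) / 2 ∈ C) :
    volume A + volume B ≤ 2 * volume C := by
  obtain ⟨a, ha⟩ := nA
  obtain ⟨b, hb⟩ := nB
  have eD : volume ((fun x => (2:ℝ)⁻¹ * x) ⁻¹' C) = 2 * volume C := by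
    rw [Real.volume_preimage_mul_left (by norm_num)]
    simp
  rw [← eD, hA.measure_eq_iSup_isCompact, hB.measure_eq_iSup_isCompact]
  simp only [iSup_and']
  refine ENNReal.biSup_add_biSup_le' (by exact ⟨∅, by simp⟩) (by exact ⟨∅, by simp⟩) ?_
  rintro K ⟨hKA, hK⟩ L ⟨hLB, hL⟩
  have := bm1_compact (D := ((fun x => (2:ℝ)⁻¹ * x) ⁻¹' C)) (hK.insert a) (hL.insert b) ⟨a, by simp⟩ ⟨b, by simp⟩ (by
    intro x hx y hy
    have hx' : x ∈ A := Set.insert_subset ha hKA hx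
    have hy' : y ∈ B := Set.insert_subset hb hLB hy
    have := h x hx' y hy'
    simp only [Set.mem_preimage]
    convert this using 1
    ring)
  refine le_trans (add_le_add (measure_mono (Set.subset_insert _ _)) (measure_mono (Set.subset_insert _ _))) this

lemma ennreal_amgm (a b : ℝ≥0∞) : 4 * (a * b) ≤ (a + b) ^ 2 := by
  wlog hab : a ≤ b generalizing a b
  · have := this b a (le_of_not_ge hab)
    rwa [mul_comm a b, add_comm a b]
  obtain ⟨c, rfl⟩ := exists_add_of_le hab
  calc 4 * (a * (a + c)) ≤ 4 * (a * (a + c)) + c ^ 2 := le_self_add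
    _ = (a + (a + c)) ^ 2 := by ring

lemma pl1_real {F G H : ℝ → ℝ} (hF : Measurable F) (hG : Measurable G) (hH : Measurable H)
    (F0 : ∀ x, 0 ≤ F x) (G0 : ∀ x, 0 ≤ G x) (H0 : ∀ x, 0 ≤ H x)
    (F1 : ∀ x, F x ≤ 1) (G1 : ∀ x, G x ≤ 1)
    (Fs : ∀ t < 1, ∃ x, t < F x) (Gs : ∀ t < 1, ∃ x, t < G x)
    (h : ∀ x y, F x * G y ≤ H ((x + y) / 2) ^ 2) :
    (∫⁻ x, ENNReal.ofReal (F x)) + (∫⁻ x, ENNReal.ofReal (G x)) ≤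
      2 * ∫⁻ x, ENNReal.ofReal (H x) := by
  rw [lintegral_eq_lintegral_meas_lt _ (Filter.Eventually.of_forall F0) hF.aemeasurable,
    lintegral_eq_lintegral_meas_lt _ (Filter.Eventually.of_forall G0) hG.aemeasurable,
    lintegral_eq_lintegral_meas_lt _ (Filter.Eventually.of_forall H0) hH.aemeasurable]
  have anti : ∀ F : ℝ → ℝ, Measurable (fun t : ℝ => volume {a | t < F a}) := by
    intro F
    apply Antitone.measurable
    intro s t hst
    exact measure_mono fun x hx => lt_of_le_of_lt hst hx
  rw [← lintegral_add_left (anti F), ← lintegral_const_mul _ (anti H)]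
  refine setLIntegral_mono ((anti H).const_mul _) ?_
  intro t ht
  have ht : 0 < t := ht
  rcases lt_or_ge t 1 with h1 | h1
  · refine bm1 (measurableSet_lt measurable_const hF) (measurableSet_lt measurable_const hG) (Fs t h1) (Gs t h1) ?_
    intro x hx y hy
    have hx : t < F x := hx
    have hy : t < G y := hy
    have := h x y
    simp only [Set.mem_ofPred_eq]
    refine lt_of_pow_lt_pow_left₀ 2 (H0 _) ?_
    nlinarith
  · have e1 : {a | t < F a} = ∅ := by
      ext x; simp; exact (F1 x).trans h1
    have e2 : {a | t < G a} = ∅ := by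
      ext x; simp; exact (G1 x).trans h1
    rw [e1, e2]; simp

lemma pl1_bdd {f g h : ℝ → ℝ≥0∞} (hf : Measurable f) (hg : Measurable g) (hh : Measurable h)
    {n : ℝ≥0∞} (hn : n ≠ ∞) (fn : ∀ x, f x ≤ n) (gn : ∀ x, g x ≤ n)
    (H : ∀ x y, f x * g y ≤ h ((x + y) / 2) ^ 2) :
    (∫⁻ x, f x) * (∫⁻ x, g x) ≤ (∫⁻ x, h x) ^ 2 := by
  set A := ⨆ x, f x with hA
  set B := ⨆ x, g x with hB
  have An : A ≠ ∞ := ne_top_of_le_ne_top hn (iSup_le fn)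
  have Bn : B ≠ ∞ := ne_top_of_le_ne_top hn (iSup_le gn)
  by_cases A0 : A = 0
  · have : ∀ x, f x = 0 := fun x => by
      have := le_iSup f x
      rw [← hA, A0] at this; simpa using this
    simp [this]
  by_cases B0 : B = 0
  · have : ∀ x, g x = 0 := fun x => by
      have := le_iSup g x
      rw [← hB, B0] at this; simpa using this
    simp [this]
  set a := A.toReal with ha
  set b := B.toReal with hb
  have a0 : 0 < a := ENNReal.toReal_pos A0 An
  have b0 : 0 < b := ENNReal.toReal_pos B0 Bn
  set s := Real.sqrt (a * b) with hs
  have s0 : 0 < s := Real.sqrt_pos.2 (by positivity)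
  have s2 : s ^ 2 = a * b := Real.sq_sqrt (by positivity)
  have fA : ∀ x, f x ≠ ∞ := fun x => ne_top_of_le_ne_top hn (fn x)
  have gA : ∀ x, g x ≠ ∞ := fun x => ne_top_of_le_ne_top hn (gn x)
  have key := pl1_real (F := fun x => (f x).toReal / a) (G := fun x => (g x).toReal / b)
    (H := fun x => (min (h x) (ENNReal.ofReal s)).toReal / s)
    (by fun_prop) (by fun_prop) (by fun_prop)
    (fun x => by positivity) (fun x => by positivity) (fun x => by positivity)
    (fun x => by
      rw [div_le_one a0]
      exact ENNReal.toReal_mono An (le_iSup f x))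
    (fun x => by
      rw [div_le_one b0]
      exact ENNReal.toReal_mono Bn (le_iSup g x))
    (fun t ht => by
      have : ENNReal.ofReal (t * a) < A := by
        rw [← ENNReal.ofReal_toReal An, ENNReal.ofReal_lt_ofReal_iff a0]
        nlinarith
      obtain ⟨x, hx⟩ := lt_iSup_iff.1 this
      refine ⟨x, ?_⟩
      rw [lt_div_iff₀ a0]
      by_contra hcon
      have := ENNReal.ofReal_le_ofReal (not_lt.1 hcon)
      rw [ENNReal.ofReal_toReal (fA x)] at this
      exact absurd hx (not_lt.2 this))
    (fun t ht => by
      have : ENNReal.ofReal (t * b) < B := by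
        rw [← ENNReal.ofReal_toReal Bn, ENNReal.ofReal_lt_ofReal_iff b0]
        nlinarith
      obtain ⟨x, hx⟩ := lt_iSup_iff.1 this
      refine ⟨x, ?_⟩
      rw [lt_div_iff₀ b0]
      by_contra hcon
      have := ENNReal.ofReal_le_ofReal (not_lt.1 hcon)
      rw [ENNReal.ofReal_toReal (gA x)] at this
      exact absurd hx (not_lt.2 this))
    (by
      intro x y
      rw [div_pow, s2, div_mul_div_comm]
      gcongr
      rw [← ENNReal.toReal_mul, ← ENNReal.toReal_pow]
      refine ENNReal.toReal_mono (by simp) ?_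
      rcases le_total (h ((x + y) / 2)) (ENNReal.ofReal s) with h1 | h1
      · rw [min_eq_left h1]; exact H x y
      · rw [min_eq_right h1, ← ENNReal.ofReal_pow s0.le, s2, ENNReal.ofReal_mul a0.le,
          ENNReal.ofReal_toReal An, ENNReal.ofReal_toReal Bn]
        exact mul_le_mul' (le_iSup f x) (le_iSup g y))
  have i1 : (∫⁻ x, f x) = A * ∫⁻ x, ENNReal.ofReal ((f x).toReal / a) := by
    rw [← lintegral_const_mul _ (by fun_prop)]
    congr 1; ext x
    rw [ENNReal.ofReal_div_of_pos a0, ENNReal.ofReal_toReal (fA x), ENNReal.ofReal_toReal An,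
      ENNReal.mul_div_cancel A0 An]
  have i2 : (∫⁻ x, g x) = B * ∫⁻ x, ENNReal.ofReal ((g x).toReal / b) := by
    rw [← lintegral_const_mul _ (by fun_prop)]
    congr 1; ext x
    rw [ENNReal.ofReal_div_of_pos b0, ENNReal.ofReal_toReal (gA x), ENNReal.ofReal_toReal Bn,
      ENNReal.mul_div_cancel B0 Bn]
  have i3 : ENNReal.ofReal s * (∫⁻ x, ENNReal.ofReal ((min (h x) (ENNReal.ofReal s)).toReal / s))
      ≤ ∫⁻ x, h x := by
    rw [← lintegral_const_mul _ (by fun_prop)]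
    refine lintegral_mono fun x => ?_
    rw [ENNReal.ofReal_div_of_pos s0, ENNReal.ofReal_toReal (by simp),
      ENNReal.mul_div_cancel (by simpa using s0) (by simp)]
    exact min_le_left _ _
  refine le_trans ?_ (pow_le_pow_left' i3 2)
  rw [i1, i2, mul_pow, ← ENNReal.ofReal_pow s0.le, s2, ENNReal.ofReal_mul a0.le,
          ENNReal.ofReal_toReal An, ENNReal.ofReal_toReal Bn]
  set P := ∫⁻ x, ENNReal.ofReal ((f x).toReal / a)
  set Q := ∫⁻ x, ENNReal.ofReal ((g x).toReal / b)
  set I := ∫⁻ x, ENNReal.ofReal ((min (h x) (ENNReal.ofReal s)).toReal / s)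
  have : P * Q ≤ I ^ 2 := by
    have h4 : 4 * (P * Q) ≤ 4 * I ^ 2 := by
      refine (ennreal_amgm P Q).trans ?_
      refine (pow_le_pow_left' key 2).trans ?_
      apply le_of_eq; ring
    exact (ENNReal.mul_le_mul_iff_right (by norm_num) (by norm_num)).1 h4
  calc A * P * (B * Q) = A * B * (P * Q) := by ring
    _ ≤ _ := by gcongr

lemma pl1 {f g h : ℝ → ℝ≥0∞} (hf : Measurable f) (hg : Measurable g) (hh : Measurable h)
    (H : ∀ x y, f x * g y ≤ h ((x + y) / 2) ^ 2) :
    (∫⁻ x, f x) * (∫⁻ x, g x) ≤ (∫⁻ x, h x) ^ 2 := by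
  have mono : ∀ f : ℝ → ℝ≥0∞, Measurable f →
      (∫⁻ x, f x) = ⨆ n : ℕ, ∫⁻ x, min (f x) n := by
    intro f hf
    rw [← lintegral_iSup (f := fun (n : ℕ) x => min (f x) (n : ℝ≥0∞)) (fun n => hf.min measurable_const) (fun m n hmn x => min_le_min_left _ (by exact_mod_cast hmn))]
    congr 1; ext x
    rw [← inf_iSup_eq, ENNReal.iSup_natCast]; simp
  rw [mono f hf, mono g hg, ENNReal.iSup_mul]
  refine iSup_le fun n => ?_
  rw [ENNReal.mul_iSup]
  refine iSup_le fun m => ?_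
  refine pl1_bdd (n := ((max n m : ℕ) : ℝ≥0∞)) (by fun_prop) (by fun_prop) hh (by simp) ?_ ?_ ?_
  · intro x; exact (min_le_right _ _).trans (by simp)
  · intro x; exact (min_le_right _ _).trans (by simp)
  · intro x y
    exact (mul_le_mul' (min_le_left _ _) (min_le_left _ _)).trans (H x y)

lemma prekopa_leindler (d : ℕ) : ∀ {f g h : (Fin d → ℝ) → ℝ≥0∞} (_ : Measurable f)
    (_ : Measurable g) (_ : Measurable h)
    (_ : ∀ x y, f x * g y ≤ h ((1/2 : ℝ) • (x + y)) ^ 2),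
    (∫⁻ x, f x) * (∫⁻ x, g x) ≤ (∫⁻ x, h x) ^ 2 := by
  induction d with
  | zero =>
    intro f g h hf hg hh H
    simp only [lintegral_unique]
    have : (volume : Measure (Fin 0 → ℝ)) Set.univ = 1 := by
      rw [volume_pi, Measure.pi_of_empty]; simp
    rw [this]
    simp only [mul_one]
    have := H default default
    convert this
  | succ d ih =>
    intro f g h hf hg hh H
    let e := (MeasurableEquiv.piFinSuccAbove (fun _ : Fin (d+1) => ℝ) 0)
    have he : MeasurePreserving e := volume_preserving_piFinSuccAbove (fun _ : Fin (d+1) => ℝ) 0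
    have conv : ∀ f : (Fin (d+1) → ℝ) → ℝ≥0∞, Measurable f →
        (∫⁻ x, f x) = ∫⁻ t : ℝ, ∫⁻ x : Fin d → ℝ, f (e.symm (t, x)) := by
      intro f hf
      rw [← (he.symm e).lintegral_comp hf, Measure.volume_eq_prod, lintegral_prod]
      exact (hf.comp e.symm.measurable).aemeasurable
    have meas : ∀ f : (Fin (d+1) → ℝ) → ℝ≥0∞, Measurable f →
        Measurable (fun t : ℝ => ∫⁻ x : Fin d → ℝ, f (e.symm (t, x))) := by
      intro f hf
      exact Measurable.lintegral_prod_right' (f := fun z : ℝ × (Fin d → ℝ) => f (e.symm z)) (hf.comp e.symm.measurable)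
    rw [conv f hf, conv g hg, conv h hh]
    refine pl1 (meas f hf) (meas g hg) (meas h hh) ?_
    intro s t
    refine ih (hf.comp (e.symm.measurable.comp (by fun_prop))) (hg.comp (e.symm.measurable.comp (by fun_prop)))
      (hh.comp (e.symm.measurable.comp (by fun_prop))) ?_
    intro x y
    refine (H _ _).trans (le_of_eq ?_)
    congr 2
    ext i
    simp only [e, MeasurableEquiv.piFinSuccAbove]
    refine Fin.cases ?_ (fun j => ?_) i
    · simp; ring
    · simp; ring

section partB
variable {E : Type*} [PseudoMetricSpace E] [MeasurableSpace E] [BorelSpace E]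
  [SecondCountableTopology E]

lemma cyc_mono {c : E → E → ℝ} {K : ℝ} (hcm : Measurable (fun z : E × E => c z.1 z.2))
    (hcb : ∀ x y, |c x y| ≤ K)
    (hcL : ∀ x y x' y', |c x y - c x' y'| ≤ K * (dist x x' + dist y y'))
    (γ : Measure (E × E)) [IsProbabilityMeasure γ]
    (hopt : ∀ γ' : Measure (E × E), IsProbabilityMeasure γ' → γ'.map Prod.fst = γ.map Prod.fst →
      γ'.map Prod.snd = γ.map Prod.snd → ∫ z, c z.1 z.2 ∂γ ≤ ∫ z, c z.1 z.2 ∂γ')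
    (N : ℕ) (z : Fin (N + 1) → E × E) (hz : ∀ i, ∀ r > 0, γ (Metric.ball (z i) r) ≠ 0) :
    ∑ i, c (z i).1 (z i).2 ≤ ∑ i, c (z (i + 1)).1 (z i).2 := by
  have hcint : ∀ γ' : Measure (E × E), IsFiniteMeasure γ' → Integrable (fun z : E × E => c z.1 z.2) γ' := by
    intro γ' h
    refine Integrable.of_bound hcm.aestronglyMeasurable K (Filter.Eventually.of_forall fun z => ?_)
    exact hcb _ _
  have K0 : 0 ≤ K := (abs_nonneg _).trans (hcb (z 0).1 (z 0).2)
  -- main estimate for each radius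
  have main : ∀ r > 0, ∑ i, c (z i).1 (z i).2 ≤ ∑ i, c (z (i + 1)).1 (z i).2 + 4 * (N + 1) * K * r := by
    intro r hr
    set m : Fin (N + 1) → ℝ≥0∞ := fun i => γ (Metric.ball (z i) r) with hm
    have m0 : ∀ i, m i ≠ 0 := fun i => hz i r hr
    have mtop : ∀ i, m i ≠ ∞ := fun i => measure_ne_top _ _
    set α : Fin (N + 1) → Measure (E × E) := fun i => (m i)⁻¹ • γ.restrict (Metric.ball (z i) r) with hα
    have αp : ∀ i, IsProbabilityMeasure (α i) := fun i => ⟨by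
      simp only [hα, Measure.smul_apply, smul_eq_mul, Measure.restrict_apply_univ]
      exact ENNReal.inv_mul_cancel (m0 i) (mtop i)⟩
    set T : ℝ≥0∞ := ∑ i, (m i)⁻¹ with hT
    have Ttop : T ≠ ∞ := by
      simp only [hT, ne_eq, ENNReal.sum_eq_top, not_exists, not_and]
      intro i _
      simpa using m0 i
    have T0 : T ≠ 0 := by
      intro h
      have := (Finset.sum_eq_zero_iff.1 h) 0 (Finset.mem_univ _)
      simp [mtop] at this
    set ε := T⁻¹ with hε
    have ε0 : ε ≠ 0 := by simpa [hε] using Ttop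
    have εtop : ε ≠ ∞ := by simpa [hε] using T0
    set A : Measure (E × E) := ε • ∑ i, α i with hA
    have Ale : A ≤ γ := by
      have h1 : ∑ i, α i ≤ T • γ := by
        rw [hT, Finset.sum_smul]
        refine Finset.sum_le_sum fun i _ => ?_
        intro s
        simp only [hα, Measure.smul_apply, smul_eq_mul]
        gcongr
        exact Measure.restrict_le_self
      intro s
      simp only [hA, Measure.smul_apply, smul_eq_mul]
      calc ε * (∑ i, α i) s ≤ ε * ((T • γ) s) := by gcongr
        _ = (ε * T) * γ s := by simp [mul_assoc]
        _ = γ s := by rw [hε, ENNReal.inv_mul_cancel T0 Ttop, one_mul]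
    have Afin : IsFiniteMeasure A := isFiniteMeasure_of_le γ Ale
    set β : Fin (N + 1) → Measure (E × E) := fun i =>
      ((α (i + 1)).map Prod.fst).prod ((α i).map Prod.snd) with hβ
    have p1 : ∀ i, IsProbabilityMeasure ((α i).map Prod.fst) := fun i =>
      Measure.isProbabilityMeasure_map measurable_fst.aemeasurable
    have p2 : ∀ i, IsProbabilityMeasure ((α i).map Prod.snd) := fun i =>
      Measure.isProbabilityMeasure_map measurable_snd.aemeasurable
    have βp : ∀ i, IsProbabilityMeasure (β i) := fun i => by
      have := p1 (i + 1)
      have := p2 i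
      simp only [hβ]; infer_instance
    set B : Measure (E × E) := ε • ∑ i, β i with hB
    have Bfin : IsFiniteMeasure B := ⟨by
      simp only [hB, Measure.smul_apply, smul_eq_mul, Measure.finsetSum_apply, measure_univ]
      exact ENNReal.mul_lt_top (lt_top_iff_ne_top.2 εtop) (by simp)⟩
    have msum : ∀ (f : E × E → E) (_ : Measurable f) (ρ : Fin (N + 1) → Measure (E × E)),
        (∑ i, ρ i).map f = ∑ i, (ρ i).map f := by
      intro f hf ρ
      ext s hs
      rw [Measure.map_apply hf hs]
      simp only [Measure.finsetSum_apply]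
      refine Finset.sum_congr rfl fun i _ => ?_
      rw [Measure.map_apply hf hs]
    have B1 : B.map Prod.fst = A.map Prod.fst := by
      simp only [hB, hA, Measure.map_smul]
      rw [msum _ measurable_fst, msum _ measurable_fst]
      congr 1
      rw [← Equiv.sum_comp (Equiv.addRight (1 : Fin (N + 1))) (fun i => (α i).map Prod.fst)]
      refine Finset.sum_congr rfl fun i _ => ?_
      have := p1 (i + 1)
      have := p2 i
      simp only [hβ]
      rw [Measure.map_fst_prod]; simp
    have B2 : B.map Prod.snd = A.map Prod.snd := by
      simp only [hB, hA, Measure.map_smul]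
      rw [msum _ measurable_snd, msum _ measurable_snd]
      congr 1
      refine Finset.sum_congr rfl fun i _ => ?_
      have := p1 (i + 1)
      have := p2 i
      simp only [hβ]
      rw [Measure.map_snd_prod]; simp
    have hdec : (γ - A) + A = γ := Measure.sub_add_cancel_of_le Ale
    have Sfin : IsFiniteMeasure (γ - A) := isFiniteMeasure_of_le γ Measure.sub_le
    have f1 : ((γ - A) + B).map Prod.fst = γ.map Prod.fst := by
      conv_rhs => rw [← hdec]
      rw [Measure.map_add _ _ measurable_fst, Measure.map_add _ _ measurable_fst, B1]
    have f2 : ((γ - A) + B).map Prod.snd = γ.map Prod.snd := by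
      conv_rhs => rw [← hdec]
      rw [Measure.map_add _ _ measurable_snd, Measure.map_add _ _ measurable_snd, B2]
    have hp : IsProbabilityMeasure ((γ - A) + B) := ⟨by
      have := congrArg (fun ρ => ρ Set.univ) f1
      simp only [Measure.map_apply measurable_fst MeasurableSet.univ, Set.preimage_univ] at this
      rw [this]; simp⟩
    have key := hopt _ hp f1 f2
    have e1 : ∫ z, c z.1 z.2 ∂γ = ∫ z, c z.1 z.2 ∂(γ - A) + ∫ z, c z.1 z.2 ∂A := by
      conv_lhs => rw [← hdec]
      exact integral_add_measure (hcint _ inferInstance) (hcint _ inferInstance)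
    rw [e1, integral_add_measure (hcint _ inferInstance) (hcint _ inferInstance)] at key
    have key2 : ∫ z, c z.1 z.2 ∂A ≤ ∫ z, c z.1 z.2 ∂B := by linarith
    simp only [hA, hB, integral_smul_measure] at key2
    have εr : 0 < ε.toReal := ENNReal.toReal_pos ε0 εtop
    rw [integral_finsetSum_measure (fun i _ => hcint _ inferInstance),
      integral_finsetSum_measure (fun i _ => hcint _ inferInstance)] at key2
    have key3 := le_of_mul_le_mul_left (by simpa only [smul_eq_mul] using key2) εr
    have αball : ∀ i, ∀ᵐ w ∂(α i), w ∈ Metric.ball (z i) r := by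
      intro i
      exact Measure.ae_smul_measure (ae_restrict_mem Metric.isOpen_ball.measurableSet) _
    have l1 : ∀ i, c (z i).1 (z i).2 - 2 * K * r ≤ ∫ w, c w.1 w.2 ∂(α i) := by
      intro i
      have : ∫ w, (c (z i).1 (z i).2 - 2 * K * r) ∂(α i) ≤ ∫ w, c w.1 w.2 ∂(α i) := by
        refine integral_mono_ae (integrable_const _) (hcint _ inferInstance) ?_
        filter_upwards [αball i] with w hw
        rw [← ball_prod_same] at hw
        have h1 : dist w.1 (z i).1 < r := hw.1
        have h2 : dist w.2 (z i).2 < r := hw.2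
        have := (abs_le.1 (hcL w.1 w.2 (z i).1 (z i).2)).1
        nlinarith
      simpa using this
    have l2 : ∀ i, ∫ w, c w.1 w.2 ∂(β i) ≤ c (z (i + 1)).1 (z i).2 + 2 * K * r := by
      intro i
      have a1 : ∀ᵐ x ∂((α (i + 1)).map Prod.fst), dist x (z (i + 1)).1 < r := by
        rw [ae_map_iff measurable_fst.aemeasurable (measurableSet_lt (by fun_prop) measurable_const)]
        filter_upwards [αball (i + 1)] with w hw
        rw [← ball_prod_same] at hw
        exact hw.1
      have a2 : ∀ᵐ x ∂((α i).map Prod.snd), dist x (z i).2 < r := by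
        rw [ae_map_iff measurable_snd.aemeasurable (measurableSet_lt (by fun_prop) measurable_const)]
        filter_upwards [αball i] with w hw
        rw [← ball_prod_same] at hw
        exact hw.2
      have : ∫ w, c w.1 w.2 ∂(β i) ≤ ∫ w, (c (z (i + 1)).1 (z i).2 + 2 * K * r) ∂(β i) := by
        refine integral_mono_ae (hcint _ inferInstance) (integrable_const _) ?_
        have := p1 (i + 1)
        have := p2 i
        have b1 : ∀ᵐ w ∂(β i), dist w.1 (z (i + 1)).1 < r :=
          Measure.quasiMeasurePreserving_fst.ae a1
        have b2 : ∀ᵐ w ∂(β i), dist w.2 (z i).2 < r :=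
          Measure.quasiMeasurePreserving_snd.ae a2
        filter_upwards [b1, b2] with w h1 h2
        have := (abs_le.1 (hcL w.1 w.2 (z (i + 1)).1 (z i).2)).2
        nlinarith
      simpa using this
    have s1 : ∑ i, (c (z i).1 (z i).2 - 2 * K * r) ≤ ∑ i, (c (z (i + 1)).1 (z i).2 + 2 * K * r) :=
      (Finset.sum_le_sum fun i _ => l1 i).trans (key3.trans (Finset.sum_le_sum fun i _ => l2 i))
    rw [Finset.sum_sub_distrib, Finset.sum_add_distrib] at s1
    simp only [Finset.sum_const, Finset.card_univ, Fintype.card_fin, nsmul_eq_mul] at s1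
    push_cast at s1
    nlinarith
  refine le_of_forall_pos_le_add fun η hη => ?_
  have hpos : 0 < 4 * (N + 1) * K + 1 := by positivity
  refine (main (η / (4 * (N + 1) * K + 1)) (by positivity)).trans ?_
  gcongr
  rw [mul_div_assoc', div_le_iff₀ hpos]
  nlinarith
end partB

section partB2
variable {E : Type*} [PseudoMetricSpace E]

/-- the transform of `φ` with respect to the cost `c`. -/
def ctr (c : E → E → ℝ) (φ : E → ℝ) (y : E) : ℝ := ⨆ x, (-c x y - φ x)

lemma ctr_bdd {c : E → E → ℝ} {φ : E → ℝ} {K M : ℝ} (hcb : ∀ x y, |c x y| ≤ K)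
    (hφ : ∀ x, |φ x| ≤ M) (y : E) : BddAbove (Set.range fun x => (-c x y - φ x)) := by
  refine ⟨K + M, ?_⟩
  rintro _ ⟨x, rfl⟩
  have := abs_le.1 (hcb x y)
  have := abs_le.1 (hφ x)
  simp only
  linarith

lemma le_ctr {c : E → E → ℝ} {φ : E → ℝ} {K M : ℝ} (hcb : ∀ x y, |c x y| ≤ K)
    (hφ : ∀ x, |φ x| ≤ M) (x y : E) : -c x y - φ x ≤ ctr c φ y :=
  le_ciSup (ctr_bdd hcb hφ y) x

lemma ctr_le [Nonempty E] {c : E → E → ℝ} {φ : E → ℝ} {y : E} {b : ℝ} (h : ∀ x, -c x y - φ x ≤ b) :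
    ctr c φ y ≤ b := ciSup_le h

lemma ctr_abs [Nonempty E] {c : E → E → ℝ} {φ : E → ℝ} {K M : ℝ} (hcb : ∀ x y, |c x y| ≤ K)
    (hφ : ∀ x, |φ x| ≤ M) (y : E) : |ctr c φ y| ≤ K + M := by
  obtain ⟨x0⟩ := ‹Nonempty E›
  have : Nonempty E := ⟨x0⟩
  rw [abs_le]
  constructor
  · have h1 := le_ctr hcb hφ x0 y
    have := abs_le.1 (hcb x0 y)
    have := abs_le.1 (hφ x0)
    linarith
  · refine ctr_le fun x => ?_
    have := abs_le.1 (hcb x y)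
    have := abs_le.1 (hφ x)
    linarith

lemma ctr_lip [Nonempty E] {c : E → E → ℝ} {φ : E → ℝ} {K M : ℝ} (hcb : ∀ x y, |c x y| ≤ K)
    (hcL : ∀ x y x' y', |c x y - c x' y'| ≤ K * (dist x x' + dist y y'))
    (hφ : ∀ x, |φ x| ≤ M) (y y' : E) : |ctr c φ y - ctr c φ y'| ≤ K * dist y y' := by
  have key : ∀ y y', ctr c φ y ≤ ctr c φ y' + K * dist y y' := by
    intro y y'
    refine ctr_le fun x => ?_
    have h1 := le_ctr hcb hφ x y'
    have h2 := abs_le.1 (hcL x y x y')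
    simp only [dist_self, zero_add] at h2
    linarith
  rw [abs_le]
  have h1 := key y y'
  have h2 := key y' y
  rw [dist_comm y' y] at h2
  constructor <;> linarith

lemma exists_potential [MeasurableSpace E] [BorelSpace E]
    [SecondCountableTopology E] {c : E → E → ℝ} {K : ℝ} (hcm : Measurable (fun z : E × E => c z.1 z.2))
    (hcb : ∀ x y, |c x y| ≤ K)
    (hcL : ∀ x y x' y', |c x y - c x' y'| ≤ K * (dist x x' + dist y y'))
    (γ : Measure (E × E)) [IsProbabilityMeasure γ]
    (hopt : ∀ γ' : Measure (E × E), IsProbabilityMeasure γ' → γ'.map Prod.fst = γ.map Prod.fst →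
      γ'.map Prod.snd = γ.map Prod.snd → ∫ z, c z.1 z.2 ∂γ ≤ ∫ z, c z.1 z.2 ∂γ') :
    ∃ φ ψ : E → ℝ, (∀ x y, 0 ≤ φ x + ψ y + c x y) ∧
      (∀ᵐ z ∂γ, φ z.1 + ψ z.2 + c z.1 z.2 = 0) ∧
      (∀ x, |φ x| ≤ 4 * K) ∧ (∀ x, |ψ x| ≤ 4 * K) ∧
      (∀ x y, |φ x - φ y| ≤ K * dist x y) ∧ (∀ x y, |ψ x - ψ y| ≤ K * dist x y) := by
  set Γ : Set (E × E) := {z | ∀ r > 0, γ (Metric.ball z r) ≠ 0} with hΓ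
  have hae : ∀ᵐ z ∂γ, z ∈ Γ := by
    have := Measure.support_mem_ae (μ := γ)
    filter_upwards [this] with z hz
    intro r hr
    exact ((Measure.mem_support_iff_forall z).1 hz _ (Metric.ball_mem_nhds z hr)).ne'
  obtain ⟨z0, hz0⟩ : ∃ z0, z0 ∈ Γ := hae.exists
  have : Nonempty E := ⟨z0.1⟩
  set V : E → Set ℝ := fun x => {t | ∃ (N : ℕ) (z : ℕ → E × E), z 0 = z0 ∧ (∀ i, z i ∈ Γ) ∧
    t = ∑ i ∈ Finset.range N, (c (z (i + 1)).1 (z i).2 - c (z i).1 (z i).2) + c x (z N).2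
      - c (z N).1 (z N).2} with hV
  have Vlow : ∀ x, ∀ t ∈ V x, -(2 * K) ≤ t := by
    rintro x t ⟨N, z, hz, hzΓ, rfl⟩
    have h := cyc_mono hcm hcb hcL γ hopt N (fun i => z i) (fun i => hzΓ i)
    rw [Fin.sum_univ_castSucc, Fin.sum_univ_castSucc] at h
    simp only [Fin.val_castSucc, Fin.coeSucc_eq_succ, Fin.val_succ, Fin.val_last, Fin.last_add_one,
      Fin.val_zero] at h
    rw [Finset.sum_sub_distrib, Finset.sum_range, Finset.sum_range]
    have := abs_le.1 (hcb x (z N).2)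
    have := abs_le.1 (hcb (z 0).1 (z N).2)
    linarith
  have V0 : ∀ x, c x z0.2 - c z0.1 z0.2 ∈ V x := by
    intro x
    exact ⟨0, fun _ => z0, rfl, fun _ => hz0, by simp⟩
  have Vstep : ∀ x y x' t, (x, y) ∈ Γ → t ∈ V x → t + c x' y - c x y ∈ V x' := by
    rintro x y x' t hxy ⟨N, z, hz, hzΓ, rfl⟩
    refine ⟨N + 1, fun i => if i ≤ N then z i else (x, y), by simp [hz], ?_, ?_⟩
    · intro i
      by_cases h : i ≤ N <;> simp [h, hzΓ, hxy]
    · rw [Finset.sum_range_succ]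
      have : ∑ i ∈ Finset.range N, (c (if i + 1 ≤ N then z (i + 1) else (x, y)).1
          (if i ≤ N then z i else (x, y)).2 - c (if i ≤ N then z i else (x, y)).1
          (if i ≤ N then z i else (x, y)).2) =
          ∑ i ∈ Finset.range N, (c (z (i + 1)).1 (z i).2 - c (z i).1 (z i).2) := by
        refine Finset.sum_congr rfl fun i hi => ?_
        have hi := Finset.mem_range.1 hi
        have h1 : i + 1 ≤ N := hi
        have h2 : i ≤ N := hi.le
        simp [h1, h2]
      simp only [this]
      simp
      ring
  have Vbdd : ∀ x, BddBelow (V x) := fun x => ⟨-(2 * K), fun t ht => Vlow x t ht⟩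
  set u : E → ℝ := fun x => sInf (V x) with hu
  have ustep : ∀ x y x', (x, y) ∈ Γ → u x' ≤ u x + c x' y - c x y := by
    intro x y x' h
    have : u x' - c x' y + c x y ≤ u x := by
      refine le_csInf ⟨_, V0 x⟩ fun t ht => ?_
      have := csInf_le (Vbdd x') (Vstep x y x' t h ht)
      simp only [hu]
      linarith
    linarith
  have ub : ∀ x, |(-u x)| ≤ 2 * K := by
    intro x
    rw [abs_neg, abs_le]
    constructor
    · exact le_csInf ⟨_, V0 x⟩ (Vlow x)
    · refine (csInf_le (Vbdd x) (V0 x)).trans ?_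
      have := abs_le.1 (hcb x z0.2)
      have := abs_le.1 (hcb z0.1 z0.2)
      linarith
  set ψ := ctr c (fun x => -u x) with hψ
  have ψb : ∀ y, |ψ y| ≤ 3 * K := fun y => (ctr_abs hcb ub y).trans (by linarith)
  have hcb' : ∀ x y, |(fun x y => c y x) x y| ≤ K := fun x y => hcb y x
  have hcL' : ∀ x y x' y', |(fun x y => c y x) x y - (fun x y => c y x) x' y'|
      ≤ K * (dist x x' + dist y y') := by
    intro x y x' y'
    rw [add_comm]; exact hcL _ _ _ _
  set φ := ctr (fun x y => c y x) ψ with hφ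
  have K0 : 0 ≤ K := (abs_nonneg _).trans (hcb z0.1 z0.2)
  refine ⟨φ, ψ, ?_, ?_, ?_, ?_, ?_, ?_⟩
  · intro x y
    have := le_ctr hcb' ψb y x
    linarith
  · filter_upwards [hae] with z hz
    have h1 : ψ z.2 ≤ -c z.1 z.2 + u z.1 := by
      refine ctr_le fun x => ?_
      have := ustep z.1 z.2 x hz
      linarith
    have h2 : φ z.1 ≤ - u z.1 := by
      refine ctr_le fun y => ?_
      have := le_ctr hcb ub z.1 y
      linarith
    have h3 := le_ctr hcb' ψb z.2 z.1
    linarith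
  · intro x
    exact (ctr_abs hcb' ψb x).trans (by linarith)
  · intro x
    exact (ψb x).trans (by linarith)
  · intro x y
    exact ctr_lip hcb' hcL' ψb x y
  · intro x y
    exact ctr_lip hcb hcL ub x y
end partB2

lemma pl_set {d : ℕ} {S : Set (Fin d → ℝ)} (hSm : MeasurableSet S) (hSc : Convex ℝ S)
    {u v w : (Fin d → ℝ) → ℝ} (hu : Measurable u) (hv : Measurable v) (hw : Measurable w)
    (iu : IntegrableOn (fun x => Real.exp (u x)) S) (iv : IntegrableOn (fun x => Real.exp (v x)) S)
    (iw : IntegrableOn (fun x => Real.exp (w x)) S)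
    (h : ∀ x ∈ S, ∀ y ∈ S, u x + v y ≤ 2 * w ((1/2 : ℝ) • (x + y))) :
    (∫ x in S, Real.exp (u x)) * (∫ x in S, Real.exp (v x)) ≤ (∫ x in S, Real.exp (w x)) ^ 2 := by
  have key := prekopa_leindler d
    (f := S.indicator (fun x => ENNReal.ofReal (Real.exp (u x))))
    (g := S.indicator (fun x => ENNReal.ofReal (Real.exp (v x))))
    (h := S.indicator (fun x => ENNReal.ofReal (Real.exp (w x))))
    (Measurable.indicator (by fun_prop) hSm) (Measurable.indicator (by fun_prop) hSm)
    (Measurable.indicator (by fun_prop) hSm) (by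
      intro x y
      by_cases hx : x ∈ S
      · by_cases hy : y ∈ S
        · have hm : (1/2 : ℝ) • (x + y) ∈ S := by
            rw [smul_add]
            exact hSc hx hy (by norm_num) (by norm_num) (by norm_num)
          rw [Set.indicator_of_mem hx, Set.indicator_of_mem hy, Set.indicator_of_mem hm,
            ← ENNReal.ofReal_mul (Real.exp_pos _).le, ← ENNReal.ofReal_pow (Real.exp_pos _).le,
            ← Real.exp_add, ← Real.exp_nat_mul]
          refine ENNReal.ofReal_le_ofReal (Real.exp_le_exp.2 ?_)
          push_cast
          exact h x hx y hy
        · rw [Set.indicator_of_notMem hy]; simp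
      · rw [Set.indicator_of_notMem hx]; simp)
  rw [lintegral_indicator hSm, lintegral_indicator hSm, lintegral_indicator hSm] at key
  have conv : ∀ u : (Fin d → ℝ) → ℝ, IntegrableOn (fun x => Real.exp (u x)) S →
      ∫⁻ x in S, ENNReal.ofReal (Real.exp (u x)) = ENNReal.ofReal (∫ x in S, Real.exp (u x)) := by
    intro u iu
    rw [ofReal_integral_eq_lintegral_ofReal iu (Filter.Eventually.of_forall fun x => (Real.exp_pos _).le)]
  have nn : ∀ u : (Fin d → ℝ) → ℝ, 0 ≤ ∫ x in S, Real.exp (u x) := fun u =>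
    integral_nonneg fun x => (Real.exp_pos _).le
  rw [conv u iu, conv v iv, conv w iw, ← ENNReal.ofReal_mul (nn u), ← ENNReal.ofReal_pow (nn w),
    ENNReal.ofReal_le_ofReal_iff (by positivity)] at key
  exact key

lemma exp_quad {t : ℝ} (ht : -2 ≤ t) : 1 + t + t ^ 2 / 4 ≤ Real.exp t := by
  have h := Real.add_one_le_exp (t / 2)
  have e : Real.exp t = Real.exp (t / 2) ^ 2 := by
    rw [← Real.exp_nat_mul]; congr 1; push_cast; ring
  rw [e]
  nlinarith [Real.exp_pos (t / 2)]

/-- squared Euclidean norm -/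
def nsq {d : ℕ} (x : Fin d → ℝ) : ℝ := ∑ i, x i ^ 2

lemma nsq_meas {d : ℕ} : Measurable (nsq : (Fin d → ℝ) → ℝ) := by
  unfold nsq; fun_prop

lemma nsq_nonneg {d : ℕ} (x : Fin d → ℝ) : 0 ≤ nsq x := Finset.sum_nonneg fun i _ => sq_nonneg _

set_option maxHeartbeats 2000000 in
lemma var_ineq {d : ℕ} {S : Set (Fin d → ℝ)} (hSm : MeasurableSet S) (hSc : Convex ℝ S)
    (hSf : volume S ≠ ∞) (hS0 : volume S ≠ 0) {R : ℝ} (hR : ∀ x ∈ S, nsq x ≤ R)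
    {φ0 φ1 g : (Fin d → ℝ) → ℝ} (m0 : Measurable φ0) (m1 : Measurable φ1) (mg : Measurable g)
    {B : ℝ} (hB : 1 ≤ B) (b0 : ∀ x, |φ0 x| ≤ B) (b1 : ∀ x, |φ1 x| ≤ B) (bg : ∀ x, |g x| ≤ B)
    (hg : ∀ x, g x ≤ (φ0 x + φ1 x) / 2)
    {L κ : ℝ} (hL : 1 ≤ L) (hκ0 : 0 ≤ κ) (hκ : κ ≤ B)
    (hmid : ∀ x ∈ S, ∀ y ∈ S, g ((1/2 : ℝ) • (x + y)) + L * nsq ((1/2 : ℝ) • (x + y)) ≤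
      (φ0 x + L * nsq x) / 2 + (φ1 y + L * nsq y) / 2 + κ) :
    ∃ a : ℝ, |a| ≤ 2 * B ∧ ∫ x in S, (φ1 x - φ0 x - a) ^ 2 ≤
      128 * B * Real.exp (2 * (1 + R)) * (1 + (volume S).toReal) * L *
        ((∫ x in S, (φ0 x + φ1 x - 2 * g x)) + κ) := by
  have hfin : IsFiniteMeasure (volume.restrict S) := ⟨by simpa using lt_top_iff_ne_top.2 hSf⟩
  obtain ⟨x0, hx0⟩ : S.Nonempty := nonempty_of_measure_ne_zero hS0
  have R0 : 0 ≤ R := (nsq_nonneg x0).trans (hR x0 hx0)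
  set s : ℝ := 1 / (2 * B * L) with hs
  have hBL : 1 ≤ B * L := by nlinarith
  have s0 : 0 < s := by positivity
  have sBL : s * (B * L) = 1 / 2 := by rw [hs]; field_simp
  have sL : s * L ≤ 1 / 2 := by
    rw [← sBL]; nlinarith [mul_pos s0 (show 0 < L by linarith)]
  have sB : s * B ≤ 1 / 2 := by
    rw [← sBL]; nlinarith [mul_pos s0 (show 0 < B by linarith)]
  set w : (Fin d → ℝ) → ℝ := fun x => Real.exp (-s * (g x + L * nsq x)) with hw
  have mw : Measurable w := by
    have := nsq_meas (d := d)
    fun_prop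
  set M := Real.exp (1 + R) with hM
  have M1 : 1 ≤ M := Real.one_le_exp (by linarith)
  have wup : ∀ x ∈ S, w x ≤ M := by
    intro x hx
    refine Real.exp_le_exp.2 ?_
    have h1 := abs_le.1 (bg x)
    have h2 := nsq_nonneg x
    nlinarith [mul_nonneg (mul_nonneg s0.le (show 0 ≤ L by linarith)) h2]
  have wlow : ∀ x ∈ S, 1 ≤ M * w x := by
    intro x hx
    rw [hM, hw, ← Real.exp_add]
    refine Real.one_le_exp ?_
    have h1 := abs_le.1 (bg x)
    have h2 := nsq_nonneg x
    have h3 := hR x hx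
    nlinarith [mul_le_mul_of_nonneg_right sL h2]
  have wpos : ∀ x, 0 < w x := fun x => Real.exp_pos _
  -- integrability of bounded functions
  have intb : ∀ (f : (Fin d → ℝ) → ℝ) (C : ℝ), Measurable f → (∀ x ∈ S, |f x| ≤ C) →
      IntegrableOn f S := by
    intro f C hf hC
    refine Integrable.of_bound hf.aestronglyMeasurable C ?_
    filter_upwards [ae_restrict_mem hSm] with x hx
    exact hC x hx
  have iw : IntegrableOn w S := intb w M mw fun x hx => by rw [abs_of_pos (wpos x)]; exact wup x hx
  have intwb : ∀ (f : (Fin d → ℝ) → ℝ) (C : ℝ), Measurable f → (∀ x, |f x| ≤ C) →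
      IntegrableOn (fun x => w x * f x) S := by
    intro f C hf hC
    refine intb _ (M * C) (mw.mul hf) fun x hx => ?_
    rw [abs_mul, abs_of_pos (wpos x)]
    exact mul_le_mul (wup x hx) (hC x) (abs_nonneg _) (by linarith)
  set W := ∫ x in S, w x with hW
  have W0 : 0 < W := by
    refine (setIntegral_pos_iff_support_of_nonneg_ae (Filter.Eventually.of_forall fun x => (wpos x).le) iw).2 ?_
    have : Function.support w = Set.univ := by
      ext x; simp [(wpos x).ne']
    rw [this, Set.univ_inter]
    exact pos_iff_ne_zero.2 hS0
  set h : (Fin d → ℝ) → ℝ := fun x => (φ1 x - φ0 x) / 2 with hh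
  have mh : Measurable h := by fun_prop
  have hb : ∀ x, |h x| ≤ B := by
    intro x
    have := abs_le.1 (b0 x)
    have := abs_le.1 (b1 x)
    rw [abs_le]; simp only [hh]
    constructor <;> linarith
  set a := (∫ x in S, w x * h x) / W with ha
  have hab : |a| ≤ B := by
    rw [ha, abs_div, abs_of_pos W0, div_le_iff₀ W0]
    refine abs_integral_le_integral_abs.trans ?_
    rw [hW, ← integral_const_mul]
    refine integral_mono ((intwb h B mh hb).abs) (iw.const_mul _) fun x => ?_
    simp only [abs_mul, abs_of_pos (wpos x)]
    rw [mul_comm]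
    exact mul_le_mul_of_nonneg_right (hb x) (wpos x).le
  set k : (Fin d → ℝ) → ℝ := fun x => h x - a with hk
  have mk : Measurable k := by fun_prop
  have kb : ∀ x, |k x| ≤ 2 * B := by
    intro x
    simp only [hk]
    exact (abs_sub _ _).trans (by linarith [hb x])
  have kint : ∫ x in S, w x * k x = 0 := by
    have : ∀ x, w x * k x = w x * h x - w x * a := fun x => by simp only [hk]; ring
    simp only [this]
    rw [integral_sub (intwb h B mh hb) (iw.mul_const _), integral_mul_const, ← hW, ha]
    field_simp; ring
  set e : (Fin d → ℝ) → ℝ := fun x => (φ0 x + φ1 x) / 2 - g x with he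
  have me : Measurable e := by fun_prop
  have e0 : ∀ x, 0 ≤ e x := fun x => by simp only [he]; linarith [hg x]
  have eb : ∀ x, e x ≤ 2 * B := by
    intro x
    have := abs_le.1 (b0 x)
    have := abs_le.1 (b1 x)
    have := abs_le.1 (bg x)
    simp only [he]; linarith
  have eb' : ∀ x, |e x| ≤ 2 * B := fun x => by rw [abs_of_nonneg (e0 x)]; exact eb x
  set X := s ^ 2 / 8 * (∫ x in S, w x * k x ^ 2) - 2 * s * ∫ x in S, w x * e x with hX
  have ksqb : ∀ x, |k x ^ 2| ≤ (2 * B) ^ 2 := fun x => by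
    rw [abs_pow]; exact pow_le_pow_left₀ (abs_nonneg _) (kb x) 2
  -- lower bound for the perturbed integrals
  have low : ∀ σ : ℝ, (σ = 1 ∨ σ = -1) →
      W + X ≤ ∫ x in S, Real.exp (-s * (g x + L * nsq x) + (s * (σ * k x) - s * e x)) := by
    intro σ hσ
    have pt : ∀ x, w x * 1 + s * σ * (w x * k x) + (s ^ 2 / 8 * (w x * k x ^ 2) - 2 * s * (w x * e x)) ≤
        Real.exp (-s * (g x + L * nsq x) + (s * (σ * k x) - s * e x)) := by
      intro x
      rw [Real.exp_add]
      have hkx := abs_le.1 (kb x)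
      have hex := eb x
      have hex0 := e0 x
      have hσk : |σ * k x| ≤ 2 * B := by
        rcases hσ with rfl | rfl
        · simpa using kb x
        · simpa using kb x
      have hσk' := abs_le.1 hσk
      have t2 : -2 ≤ s * (σ * k x) - s * e x := by nlinarith
      have q := exp_quad t2
      have σ2 : (σ * k x) ^ 2 = k x ^ 2 := by
        rcases hσ with rfl | rfl <;> ring
      have : 1 + s * (σ * k x) + (s ^ 2 / 8 * k x ^ 2 - 2 * s * e x) ≤
          Real.exp (s * (σ * k x) - s * e x) := by
        refine le_trans ?_ q
        have i1 : (s * (σ * k x) - s * e x) ^ 2 ≥ s ^ 2 * k x ^ 2 / 2 - (s * e x) ^ 2 := by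
          rw [← σ2]
          nlinarith [sq_nonneg (s * (σ * k x) - 2 * (s * e x))]
        have i2 : (s * e x) ^ 2 ≤ s * e x := by
          have : s * e x ≤ 1 := by nlinarith
          nlinarith [mul_nonneg s0.le hex0]
        nlinarith [mul_nonneg s0.le hex0]
      calc _ = w x * (1 + s * (σ * k x) + (s ^ 2 / 8 * k x ^ 2 - 2 * s * e x)) := by ring
        _ ≤ _ := mul_le_mul_of_nonneg_left this (wpos x).le
    have ileft : IntegrableOn (fun x => w x * 1 + s * σ * (w x * k x) + (s ^ 2 / 8 * (w x * k x ^ 2) - 2 * s * (w x * e x))) S := by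
      refine Integrable.add (Integrable.add ?_ ?_) (Integrable.sub ?_ ?_)
      · simp only [mul_one]; exact iw
      · exact (intwb k _ mk kb).const_mul _
      · exact (intwb _ _ (mk.pow_const 2) ksqb).const_mul _
      · exact (intwb e _ me eb').const_mul _
    have : W + X = ∫ x in S, (w x * 1 + s * σ * (w x * k x) + (s ^ 2 / 8 * (w x * k x ^ 2) - 2 * s * (w x * e x))) := by
      have j1 : IntegrableOn (fun x => w x * 1) S := by simpa using iw
      have j2 : IntegrableOn (fun x => s * σ * (w x * k x)) S := (intwb k _ mk kb).const_mul _
      have j3 : IntegrableOn (fun x => s ^ 2 / 8 * (w x * k x ^ 2)) S := (intwb _ _ (mk.pow_const 2) ksqb).const_mul _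
      have j4 : IntegrableOn (fun x => 2 * s * (w x * e x)) S := (intwb e _ me eb').const_mul _
      have E1 := integral_add (j1.add j2) (j3.sub j4)
      have E2 := integral_add j1 j2
      have E3 := integral_sub j3 j4
      simp only [Pi.add_apply, Pi.sub_apply] at E1 E2 E3
      rw [E1, E2, E3,
        integral_const_mul, integral_const_mul, integral_const_mul, kint]
      simp only [mul_one, mul_zero, add_zero]
      rw [← hW]
    rw [this]
    refine integral_mono ileft ?_ pt
    refine intb _ (M * Real.exp 2) ?_ fun x hx => ?_
    · have := nsq_meas (d := d)
      fun_prop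
    · rw [abs_of_pos (Real.exp_pos _), Real.exp_add]
      refine mul_le_mul (wup x hx) (Real.exp_le_exp.2 ?_) (Real.exp_pos _).le (by linarith)
      have hkx := abs_le.1 (kb x)
      have hex0 := e0 x
      rcases hσ with rfl | rfl <;> nlinarith [mul_nonneg s0.le hex0]
  -- Prékopa–Leindler
  have iexp : ∀ u : (Fin d → ℝ) → ℝ, Measurable u → (∀ x ∈ S, u x ≤ 100 * (B * L) * (1 + R)) →
      IntegrableOn (fun x => Real.exp (u x)) S := by
    intro u mu hu
    refine intb _ (Real.exp (100 * (B * L) * (1 + R))) (by fun_prop) fun x hx => ?_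
    rw [abs_of_pos (Real.exp_pos _)]
    exact Real.exp_le_exp.2 (hu x hx)
  have big : ∀ t : ℝ, t ≤ 100 → t ≤ 100 * (B * L) * (1 + R) := by
    intro t ht
    nlinarith [mul_nonneg (show 0 ≤ B * L by linarith) R0]
  have mns := nsq_meas (d := d)
  have sub : ∀ x ∈ S, 0 ≤ s * (L * nsq x) := fun x hx =>
    mul_nonneg s0.le (mul_nonneg (by linarith) (nsq_nonneg x))
  have ubd : ∀ σ : ℝ, (σ = 1 ∨ σ = -1) → ∀ x ∈ S,
      -s * (g x + L * nsq x) + (s * (σ * k x) - s * e x) ≤ 100 := by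
    intro σ hσ x hx
    have hkx := abs_le.1 (kb x)
    have hex0 := e0 x
    have := abs_le.1 (bg x)
    have := sub x hx
    rcases hσ with rfl | rfl <;> nlinarith [mul_nonneg s0.le hex0]
  have PL := pl_set hSm hSc
    (u := fun x => -s * (g x + L * nsq x) + (s * (1 * k x) - s * e x))
    (v := fun x => -s * (g x + L * nsq x) + (s * (-1 * k x) - s * e x))
    (w := fun x => s * κ + -s * (g x + L * nsq x))
    (by fun_prop) (by fun_prop) (by fun_prop)
    (iexp _ (by fun_prop) fun x hx => big _ (ubd 1 (Or.inl rfl) x hx))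
    (iexp _ (by fun_prop) fun x hx => big _ (ubd (-1) (Or.inr rfl) x hx))
    (iexp _ (by fun_prop) fun x hx => big _ (by
      have := abs_le.1 (bg x)
      have := sub x hx
      nlinarith))
    (by
      intro x hx y hy
      have := hmid x hx y hy
      simp only [hk, he, hh]
      nlinarith)
  have eW : ∫ x in S, Real.exp (s * κ + -s * (g x + L * nsq x)) = Real.exp (s * κ) * W := by
    simp only [Real.exp_add]
    rw [integral_const_mul]
  rw [eW] at PL
  have l1 := low 1 (Or.inl rfl)
  have l2 := low (-1) (Or.inr rfl)
  have XW : W + X ≤ Real.exp (s * κ) * W := by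
    by_contra hcon
    push Not at hcon
    have pos : 0 < Real.exp (s * κ) * W := by positivity
    nlinarith
  have sκ : s * κ ≤ 1 := by nlinarith
  have exb : Real.exp (s * κ) ≤ 1 + 2 * (s * κ) := by
    have h1 := Real.abs_exp_sub_one_sub_id_le (x := s * κ) (by rw [abs_of_nonneg (by positivity)]; exact sκ)
    have h2 := (abs_le.1 h1).2
    nlinarith [mul_nonneg s0.le hκ0]
  have X1 : X ≤ 2 * (s * κ) * W := by nlinarith
  have main : ∫ x in S, w x * k x ^ 2 ≤ 32 * (B * L) * ((∫ x in S, w x * e x) + κ * W) := by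
    have h1 : s * (s / 8 * (∫ x in S, w x * k x ^ 2)) ≤ s * (2 * ((∫ x in S, w x * e x) + κ * W)) := by
      rw [hX] at X1; nlinarith
    have h2 := le_of_mul_le_mul_left h1 s0
    have h3 : s * (16 * (B * L)) = 8 := by linarith
    have h4 : (∫ x in S, w x * k x ^ 2) = (16 * (B * L)) * (s / 8 * (∫ x in S, w x * k x ^ 2)) := by
      have : (16 * (B * L)) * (s / 8 * (∫ x in S, w x * k x ^ 2)) =
        (s * (16 * (B * L))) / 8 * (∫ x in S, w x * k x ^ 2) := by ring
      rw [this, h3]; ring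
    rw [h4]
    nlinarith
  have iE : IntegrableOn e S := intb e _ me fun x _ => eb' x
  have up1 : ∫ x in S, w x * e x ≤ M * ∫ x in S, e x := by
    rw [← integral_const_mul]
    refine setIntegral_mono_on (intwb e _ me eb') (iE.const_mul _) hSm fun x hx => ?_
    exact mul_le_mul_of_nonneg_right (wup x hx) (e0 x)
  have up2 : W ≤ M * (volume S).toReal := by
    have : ∫ x in S, w x ≤ ∫ x in S, M := setIntegral_mono_on iw (integrable_const _) hSm wup
    simpa [mul_comm, Measure.real] using this
  have lo : ∫ x in S, k x ^ 2 ≤ M * ∫ x in S, w x * k x ^ 2 := by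
    rw [← integral_const_mul]
    refine setIntegral_mono_on (intb _ _ (mk.pow_const 2) fun x _ => ksqb x)
      ((intwb _ _ (mk.pow_const 2) ksqb).const_mul _) hSm fun x hx => ?_
    rw [← mul_assoc]
    exact le_mul_of_one_le_left (sq_nonneg _) (wlow x hx)
  refine ⟨2 * a, by rw [abs_mul]; norm_num; exact hab, ?_⟩
  have eq1 : ∫ x in S, (φ1 x - φ0 x - 2 * a) ^ 2 = 4 * ∫ x in S, k x ^ 2 := by
    rw [← integral_const_mul]
    congr 1; ext x; simp only [hk, hh]; ring
  have eq2 : ∫ x in S, (φ0 x + φ1 x - 2 * g x) = 2 * ∫ x in S, e x := by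
    rw [← integral_const_mul]
    congr 1; ext x; simp only [he]; ring
  rw [eq1, eq2]
  have MM : Real.exp (2 * (1 + R)) = M ^ 2 := by
    rw [hM, ← Real.exp_nat_mul]; norm_num
  rw [MM]
  set V := (volume S).toReal with hV
  have V0 : 0 ≤ V := ENNReal.toReal_nonneg
  set I := ∫ x in S, e x with hI
  have I0 : 0 ≤ I := integral_nonneg e0
  have c1 : ∫ x in S, k x ^ 2 ≤ M * (32 * (B * L) * (M * I + κ * (M * V))) := by
    refine lo.trans ?_
    refine mul_le_mul_of_nonneg_left (main.trans ?_) (by linarith)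
    refine mul_le_mul_of_nonneg_left ?_ (by nlinarith)
    exact add_le_add up1 (mul_le_mul_of_nonneg_left up2 hκ0)
  calc 4 * ∫ x in S, k x ^ 2 ≤ 4 * (M * (32 * (B * L) * (M * I + κ * (M * V)))) := by linarith
    _ = 128 * B * M ^ 2 * L * (I + κ * V) := by ring
    _ ≤ 128 * B * M ^ 2 * L * ((1 + V) * (2 * I + κ)) := by
        refine mul_le_mul_of_nonneg_left ?_ (by positivity)
        nlinarith [mul_nonneg V0 I0]
    _ = _ := by ring

lemma trans_vol {d : ℕ} {S : Set (Fin d → ℝ)} (hSm : MeasurableSet S) (hSc : Convex ℝ S)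
    (hSf : volume S ≠ ∞) {x0 : Fin d → ℝ} {η : ℝ} (hη : 0 < η) (hball : Metric.closedBall x0 η ⊆ S)
    (v : Fin d → ℝ) :
    (volume {x | x ∈ S ∧ x + v ∉ S}).toReal ≤ ((d + 1) / η * (volume S).toReal) * ‖v‖ := by
  have V0 : 0 ≤ (volume S).toReal := ENNReal.toReal_nonneg
  set τ := ‖v‖ / η with hτ
  have τ0 : 0 ≤ τ := by positivity
  have e1 : ((d + 1) / η * (volume S).toReal) * ‖v‖ = (d + 1) * τ * (volume S).toReal := by
    rw [hτ]; ring
  rw [e1]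
  have sub0 : {x | x ∈ S ∧ x + v ∉ S} ⊆ S := fun x hx => hx.1
  rcases le_or_gt 1 τ with h1 | h1
  · calc (volume {x | x ∈ S ∧ x + v ∉ S}).toReal ≤ (volume S).toReal :=
          ENNReal.toReal_mono hSf (measure_mono sub0)
      _ ≤ _ := by
          refine le_mul_of_one_le_left V0 ?_
          have : (0:ℝ) ≤ d := Nat.cast_nonneg d
          nlinarith
  rcases eq_or_lt_of_le τ0 with h0 | h0
  · have hv : v = 0 := by
      have : ‖v‖ = 0 := by
        have : ‖v‖ = τ * η := by rw [hτ]; field_simp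
        rw [this, ← h0, zero_mul]
      exact norm_eq_zero.1 this
    subst hv
    have : {x | x ∈ S ∧ x + 0 ∉ S} = ∅ := by
      ext x; simp
    rw [this, ← h0]; simp
  set S' := AffineMap.homothety x0 (1 - τ) '' S with hS'
  have x0S : x0 ∈ S := hball (Metric.mem_closedBall_self hη.le)
  have hS'S : S' ⊆ S := by
    rintro _ ⟨s, hs, rfl⟩
    rw [AffineMap.homothety_apply, vsub_eq_sub, vadd_eq_add]
    have : (1 - τ) • (s - x0) + x0 = (1 - τ) • s + τ • x0 := by
      module
    rw [this]
    exact hSc hs x0S (by linarith) τ0 (by ring)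
  have sub : {x | x ∈ S ∧ x + v ∉ S} ⊆ S \ S' := by
    rintro x ⟨hx, hxv⟩
    refine ⟨hx, ?_⟩
    rintro ⟨s, hs, rfl⟩
    apply hxv
    rw [AffineMap.homothety_apply, vsub_eq_sub, vadd_eq_add]
    have : (1 - τ) • (s - x0) + x0 + v = (1 - τ) • s + τ • (x0 + τ⁻¹ • v) := by
      rw [smul_add, smul_smul, mul_inv_cancel₀ h0.ne']
      module
    rw [this]
    refine hSc hs (hball ?_) (by linarith) τ0 (by ring)
    rw [Metric.mem_closedBall, dist_eq_norm, add_sub_cancel_left, norm_smul, norm_inv,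
      Real.norm_of_nonneg τ0, hτ]
    have : ‖v‖ ≠ 0 := by
      intro h; rw [hτ, h] at h0; simp at h0
    have h9 := hη.ne'
    have : (‖v‖ / η)⁻¹ * ‖v‖ = η := by field_simp
    exact this.le
  have conv' : Convex ℝ S' := hSc.affine_image _
  have nm : NullMeasurableSet S' volume := conv'.nullMeasurableSet volume
  have vol' : volume S' = ENNReal.ofReal ((1 - τ) ^ d) * volume S := by
    rw [hS', Measure.addHaar_image_homothety]
    simp only [Module.finrank_fin_fun]
    rw [abs_of_nonneg (pow_nonneg (by linarith) _)]
  have fin' : volume S' ≠ ∞ := ne_top_of_le_ne_top hSf (measure_mono hS'S)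
  have fd : volume (S \ S') ≠ ∞ := ne_top_of_le_ne_top hSf (measure_mono Set.sdiff_subset)
  calc (volume {x | x ∈ S ∧ x + v ∉ S}).toReal ≤ (volume (S \ S')).toReal :=
        ENNReal.toReal_mono fd (measure_mono sub)
    _ = (volume S).toReal - (1 - τ) ^ d * (volume S).toReal := by
        rw [measure_sdiff hS'S nm fin', ENNReal.toReal_sub_of_le (measure_mono hS'S) hSf, vol',
          ENNReal.toReal_mul, ENNReal.toReal_ofReal (pow_nonneg (by linarith) _)]
    _ ≤ _ := by
        have := one_add_mul_le_pow (a := -τ) (by linarith) d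
        have e : 1 + -τ = 1 - τ := by ring
        rw [e] at this
        nlinarith [mul_nonneg τ0 V0, mul_le_mul_of_nonneg_right this V0]

lemma second_diff {d : ℕ} {S : Set (Fin d → ℝ)} (hSm : MeasurableSet S) (hSf : volume S ≠ ∞)
    {C2 : ℝ} (hC2 : ∀ v : Fin d → ℝ, (volume {x | x ∈ S ∧ x + v ∉ S}).toReal ≤ C2 * ‖v‖)
    {φ : (Fin d → ℝ) → ℝ} (mφ : Measurable φ) {K : ℝ} (hK : ∀ x y, |φ x - φ y| ≤ K * dist x y)
    (hK0 : 0 ≤ K) (v : Fin d → ℝ) :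
    ∫ x in S, (φ (x + v) - 2 * φ x + φ (x - v)) ≤ 2 * K * C2 * ‖v‖ ^ 2 := by
  have hfin : IsFiniteMeasure (volume.restrict S) := ⟨by simpa using lt_top_iff_ne_top.2 hSf⟩
  set u : (Fin d → ℝ) → ℝ := fun x => φ (x + v) - φ x with hu
  have mu : Measurable u := by fun_prop
  have ub : ∀ x, |u x| ≤ K * ‖v‖ := by
    intro x
    have := hK (x + v) x
    simpa [dist_eq_norm] using this
  have i1 : IntegrableOn u S := Integrable.of_bound mu.aestronglyMeasurable (K * ‖v‖)
    (Filter.Eventually.of_forall ub)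
  have i2 : IntegrableOn (fun x => u (x - v)) S :=
    Integrable.of_bound (Measurable.aestronglyMeasurable (by fun_prop)) (K * ‖v‖) (Filter.Eventually.of_forall fun x => ub _)
  have e1 : ∫ x in S, (φ (x + v) - 2 * φ x + φ (x - v)) = (∫ x in S, u x) - ∫ x in S, u (x - v) := by
    rw [← integral_sub i1 i2]
    congr 1; ext x; simp only [hu, sub_add_cancel]; ring
  have e2 : ∫ x in S, u (x - v) = ∫ x in {x | x + v ∈ S}, u x := by
    rw [← integral_indicator hSm, ← integral_indicator (by
      exact (measurable_add_const v) hSm),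
      ← integral_add_right_eq_self (μ := volume) (S.indicator fun x => u (x - v)) v]
    congr 1; ext x
    by_cases hx : x + v ∈ S
    · rw [Set.indicator_of_mem hx, Set.indicator_of_mem (by exact hx), add_sub_cancel_right]
    · rw [Set.indicator_of_notMem hx, Set.indicator_of_notMem (by exact hx)]
  have mT : MeasurableSet {x | x + v ∈ S} := (measurable_add_const v) hSm
  have volT : volume {x | x + v ∈ S} = volume S := measure_preimage_add_right volume v S
  have iT : IntegrableOn u {x | x + v ∈ S} := by
    have : IsFiniteMeasure (volume.restrict {x | x + v ∈ S}) :=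
      ⟨by simpa [volT] using lt_top_iff_ne_top.2 hSf⟩
    exact Integrable.of_bound mu.aestronglyMeasurable (K * ‖v‖) (Filter.Eventually.of_forall ub)
  rw [e1, e2]
  have d1 := integral_inter_add_sdiff (μ := volume) mT i1
  have d2 := integral_inter_add_sdiff (μ := volume) hSm iT
  rw [Set.inter_comm] at d2
  have bA : |∫ x in S \ {x | x + v ∈ S}, u x| ≤ K * ‖v‖ * (C2 * ‖v‖) := by
    have h := norm_setIntegral_le_of_norm_le_const (μ := volume) (s := S \ {x | x + v ∈ S}) (f := u)
      (C := K * ‖v‖) (lt_of_le_of_lt (measure_mono Set.sdiff_subset) (lt_top_iff_ne_top.2 hSf))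
      (fun x _ => ub x)
    refine h.trans (mul_le_mul_of_nonneg_left (hC2 v) (by positivity))
  have bB : |∫ x in {x | x + v ∈ S} \ S, u x| ≤ K * ‖v‖ * (C2 * ‖v‖) := by
    have h := norm_setIntegral_le_of_norm_le_const (μ := volume) (s := {x | x + v ∈ S} \ S) (f := u)
      (C := K * ‖v‖) (lt_of_le_of_lt (measure_mono Set.sdiff_subset) (by rw [volT]; exact (lt_top_iff_ne_top.2 hSf)))
      (fun x _ => ub x)
    refine h.trans (mul_le_mul_of_nonneg_left ?_ (by positivity))
    have h2 := hC2 (-v)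
    rw [norm_neg] at h2
    have : volume ({x | x + v ∈ S} \ S) = volume {x | x ∈ S ∧ x + -v ∉ S} := by
      rw [← measure_preimage_add_right volume v {x | x ∈ S ∧ x + -v ∉ S}]
      congr 1; ext x; simp
    rw [Measure.real, this]; exact h2
  have := (abs_le.1 bA).2
  have := (abs_le.1 bB).1
  nlinarith

lemma dq_pt {K G C1 ρ r f fp fm q : ℝ} (hr : 0 < r) (hK : 0 ≤ K) (hCρ : 0 ≤ C1 * ρ)
    (l1 : |fp - f| ≤ K * r) (hq : |q| ≤ G)
    (h1 : f + r * q - C1 * r * ρ ≤ fp) (h2 : f - r * q - C1 * r * ρ ≤ fm) :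
    (q - (fp - f) / r) ^ 2 ≤ (K + G) * ((fp - 2 * f + fm) / r + 3 * C1 * ρ) := by
  set D := (fp - f) / r with hD
  set E := (f - fm) / r with hE
  have e1 : fp - f = r * D := by rw [hD]; field_simp
  have e2 : f - fm = r * E := by rw [hE]; field_simp
  have e3 : (fp - 2 * f + fm) / r = D - E := by rw [hD, hE]; ring
  rw [e3]
  have a1 : q - C1 * ρ ≤ D := by
    refine le_of_mul_le_mul_left ?_ hr
    rw [← e1]; linarith
  have a2 : E ≤ q + C1 * ρ := by
    refine le_of_mul_le_mul_left ?_ hr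
    rw [← e2]; linarith
  have a3 : |D| ≤ K := by
    rw [hD, abs_div, abs_of_pos hr, div_le_iff₀ hr]; exact l1
  have b1 : |q - D| ≤ D - E + 3 * C1 * ρ := by
    rw [abs_le]; constructor <;> linarith
  have b2 : |q - D| ≤ K + G := (abs_sub _ _).trans (by linarith)
  rw [← sq_abs, sq]
  exact mul_le_mul b2 b1 (abs_nonneg _) (by linarith [abs_nonneg q])

lemma tri3 (a b x y : ℝ) : (a - b) ^ 2 ≤ 3 * (a - x) ^ 2 + 3 * (b - y) ^ 2 + 3 * (y - x) ^ 2 := by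
  nlinarith [sq_nonneg ((a - x) + (b - y)), sq_nonneg ((a - x) + (y - x)),
    sq_nonneg ((b - y) - (y - x))]

set_option maxHeartbeats 1000000 in
lemma dq_est {d : ℕ} {S : Set (Fin d → ℝ)} (hSm : MeasurableSet S) (hSf : volume S ≠ ∞)
    {C2 : ℝ} (hC2 : ∀ v : Fin d → ℝ, (volume {x | x ∈ S ∧ x + v ∉ S}).toReal ≤ C2 * ‖v‖)
    {φ0 φ1 q0 q1 : (Fin d → ℝ) → ℝ} (m0 : Measurable φ0) (m1 : Measurable φ1)
    (mq0 : Measurable q0) (mq1 : Measurable q1) {K G B C1 ρ r a : ℝ}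
    (hK0 : ∀ x y, |φ0 x - φ0 y| ≤ K * dist x y) (hK1 : ∀ x y, |φ1 x - φ1 y| ≤ K * dist x y)
    (hK : 0 ≤ K) (b0 : ∀ x, |φ0 x| ≤ B) (b1 : ∀ x, |φ1 x| ≤ B)
    (g0 : ∀ᵐ x ∂(volume.restrict S), |q0 x| ≤ G) (g1 : ∀ᵐ x ∂(volume.restrict S), |q1 x| ≤ G)
    (hG : 0 ≤ G) (hCρ : 0 ≤ C1 * ρ)
    (hr : 0 < r) (v : Fin d → ℝ) (hv : ‖v‖ = r)
    (p0 : ∀ᵐ x ∂(volume.restrict S), φ0 x + r * q0 x - C1 * r * ρ ≤ φ0 (x + v) ∧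
      φ0 x - r * q0 x - C1 * r * ρ ≤ φ0 (x - v))
    (p1 : ∀ᵐ x ∂(volume.restrict S), φ1 x + r * q1 x - C1 * r * ρ ≤ φ1 (x + v) ∧
      φ1 x - r * q1 x - C1 * r * ρ ≤ φ1 (x - v)) :
    ∫ x in S, (q0 x - q1 x) ^ 2 ≤ 12 * (K + G) * K * C2 * r
      + 18 * (K + G) * C1 * ρ * (volume S).toReal + 4 * G ^ 2 * C2 * r
      + 12 * (∫ x in S, (φ1 x - φ0 x - a) ^ 2) / r ^ 2 := by
  have hfin : IsFiniteMeasure (volume.restrict S) := ⟨by simpa using lt_top_iff_ne_top.2 hSf⟩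
  have mT : MeasurableSet {x | x + v ∈ S} := (measurable_add_const v) hSm
  set h : (Fin d → ℝ) → ℝ := fun x => φ1 x - φ0 x - a with hh
  have mh : Measurable h := by fun_prop
  have hb : ∀ x, |h x ^ 2| ≤ (2 * B + |a|) ^ 2 := by
    intro x
    rw [abs_pow]
    refine pow_le_pow_left₀ (abs_nonneg _) ?_ 2
    have := b0 x; have := b1 x
    have h1 := abs_sub (φ1 x - φ0 x) a
    have h2 := abs_sub (φ1 x) (φ0 x)
    simp only [hh]; linarith
  have intb : ∀ (f : (Fin d → ℝ) → ℝ) (C : ℝ), Measurable f → (∀ᵐ x ∂(volume.restrict S), |f x| ≤ C) →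
      IntegrableOn f S := fun f C hf hC => Integrable.of_bound hf.aestronglyMeasurable C hC
  set sd0 : (Fin d → ℝ) → ℝ := fun x => φ0 (x + v) - 2 * φ0 x + φ0 (x - v) with hsd0
  set sd1 : (Fin d → ℝ) → ℝ := fun x => φ1 (x + v) - 2 * φ1 x + φ1 (x - v) with hsd1
  have isd : ∀ φ : (Fin d → ℝ) → ℝ, Measurable φ → (∀ x, |φ x| ≤ B) →
      IntegrableOn (fun x => φ (x + v) - 2 * φ x + φ (x - v)) S := by
    intro φ mφ bφ
    refine intb _ (4 * B) (by fun_prop) (Filter.Eventually.of_forall fun x => ?_)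
    have := abs_le.1 (bφ x)
    have := abs_le.1 (bφ (x + v))
    have := abs_le.1 (bφ (x - v))
    rw [abs_le]; constructor <;> linarith
  have is0 : IntegrableOn sd0 S := isd φ0 m0 b0
  have is1 : IntegrableOn sd1 S := isd φ1 m1 b1
  set T : Set (Fin d → ℝ) := {x | x + v ∈ S} with hT
  set H : (Fin d → ℝ) → ℝ := T.indicator (fun x => h (x + v) ^ 2) with hH
  set J : (Fin d → ℝ) → ℝ := Tᶜ.indicator (fun _ => (1 : ℝ)) with hJ
  have mH : Measurable H := Measurable.indicator (by fun_prop) mT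
  have mJ : Measurable J := Measurable.indicator (by fun_prop) mT.compl
  have H0 : ∀ x, 0 ≤ H x := fun x => Set.indicator_nonneg (fun x _ => sq_nonneg _) x
  have J0 : ∀ x, 0 ≤ J x := fun x => Set.indicator_nonneg (fun x _ => zero_le_one) x
  have iH : IntegrableOn H S := intb _ ((2 * B + |a|) ^ 2) mH (Filter.Eventually.of_forall fun x => by
    rw [abs_of_nonneg (H0 x), hH]
    by_cases hx : x ∈ T
    · rw [Set.indicator_of_mem hx]
      exact (le_abs_self _).trans (hb _)
    · rw [Set.indicator_of_notMem hx]
      positivity)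
  have iJ : IntegrableOn J S := intb _ 1 mJ (Filter.Eventually.of_forall fun x => by
    rw [abs_of_nonneg (J0 x), hJ]
    exact Set.indicator_le_self' (fun _ _ => zero_le_one) x)
  have ih : IntegrableOn (fun x => h x ^ 2) S := intb _ _ (by fun_prop) (Filter.Eventually.of_forall hb)
  have pt : ∀ᵐ x ∂(volume.restrict S), (q0 x - q1 x) ^ 2 ≤
      3 * (K + G) / r * (sd0 x + sd1 x) + (18 * (K + G) * C1 * ρ) + 6 / r ^ 2 * (h x ^ 2 + H x)
      + 4 * G ^ 2 * J x := by
    filter_upwards [g0, g1, p0, p1] with x g0 g1 p0 p1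
    have l0 : |φ0 (x + v) - φ0 x| ≤ K * r := by
      have := hK0 (x + v) x; simpa [dist_eq_norm, hv] using this
    have l1 : |φ1 (x + v) - φ1 x| ≤ K * r := by
      have := hK1 (x + v) x; simpa [dist_eq_norm, hv] using this
    have z0 := dq_pt hr hK hCρ l0 g0 p0.1 p0.2
    have z1 := dq_pt hr hK hCρ l1 g1 p1.1 p1.2
    have E : 3 * ((K + G) * ((φ0 (x + v) - 2 * φ0 x + φ0 (x - v)) / r + 3 * C1 * ρ)) +
        3 * ((K + G) * ((φ1 (x + v) - 2 * φ1 x + φ1 (x - v)) / r + 3 * C1 * ρ)) =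
        3 * (K + G) / r * (sd0 x + sd1 x) + (18 * (K + G) * C1 * ρ) := by
      simp only [hsd0, hsd1]; ring
    rw [← E]
    by_cases hx : x ∈ T
    · have e1 : H x = h (x + v) ^ 2 := Set.indicator_of_mem hx _
      have e2 : J x = 0 := Set.indicator_of_notMem (by simpa using hx) _
      rw [e1, e2]
      set D0 := (φ0 (x + v) - φ0 x) / r with hD0
      set D1 := (φ1 (x + v) - φ1 x) / r with hD1
      have eD : D1 - D0 = (h (x + v) - h x) / r := by
        rw [hD0, hD1]; simp only [hh]; ring
      have : (D1 - D0) ^ 2 ≤ 2 / r ^ 2 * (h x ^ 2 + h (x + v) ^ 2) := by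
        rw [eD, div_pow, div_mul_eq_mul_div]
        refine div_le_div_of_nonneg_right ?_ (by positivity)
        nlinarith [sq_nonneg (h (x + v) + h x)]
      have e6 : 6 / r ^ 2 * (h x ^ 2 + h (x + v) ^ 2) = 3 * (2 / r ^ 2 * (h x ^ 2 + h (x + v) ^ 2)) := by ring
      rw [e6]
      have tri : (q0 x - q1 x) ^ 2 ≤ 3 * (q0 x - D0) ^ 2 + 3 * (q1 x - D1) ^ 2 + 3 * (D1 - D0) ^ 2 := by
        exact tri3 _ _ _ _
      linarith
    · have e2 : J x = 1 := Set.indicator_of_mem (by simpa using hx) _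
      rw [e2]
      have := abs_le.1 g0
      have := abs_le.1 g1
      have : (q0 x - q1 x) ^ 2 ≤ (2 * G) ^ 2 := sq_le_sq' (by linarith) (by linarith)
      have := mul_nonneg (show 0 ≤ 6 / r ^ 2 by positivity) (add_nonneg (sq_nonneg (h x)) (H0 x))
      nlinarith [sq_nonneg (q0 x - (φ0 (x + v) - φ0 x) / r), sq_nonneg (q1 x - (φ1 (x + v) - φ1 x) / r)]
  have iq : IntegrableOn (fun x => (q0 x - q1 x) ^ 2) S := by
    refine intb _ ((2 * G) ^ 2) (by fun_prop) ?_
    filter_upwards [g0, g1] with x g0 g1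
    have := abs_le.1 g0
    have := abs_le.1 g1
    rw [abs_of_nonneg (sq_nonneg _)]
    exact sq_le_sq' (by linarith) (by linarith)
  have j1 : IntegrableOn (fun x => 3 * (K + G) / r * (sd0 x + sd1 x)) S := (is0.add is1).const_mul _
  have j2 : IntegrableOn (fun _ : Fin d → ℝ => 18 * (K + G) * C1 * ρ) S := integrable_const _
  have j3 : IntegrableOn (fun x => 6 / r ^ 2 * (h x ^ 2 + H x)) S := (ih.add iH).const_mul _
  have j4 : IntegrableOn (fun x => 4 * G ^ 2 * J x) S := iJ.const_mul _
  have step := integral_mono_ae iq (((j1.add j2).add j3).add j4) pt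
  have E1 := integral_add ((j1.add j2).add j3) j4
  have E2 := integral_add (j1.add j2) j3
  have E3 := integral_add j1 j2
  have E4 := integral_add is0 is1
  have E5 := integral_add ih iH
  simp only [Pi.add_apply] at E1 E2 E3 E4 E5 step
  have CC : ∫ x in S, (18 * (K + G) * C1 * ρ) = 18 * (K + G) * C1 * ρ * (volume S).toReal := by
    simp [Measure.real]; ring
  rw [E1, E2, E3, CC, integral_const_mul, integral_const_mul, integral_const_mul, E4, E5] at step
  have s0 := second_diff hSm hSf hC2 m0 hK0 hK v
  have s1 := second_diff hSm hSf hC2 m1 hK1 hK v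
  rw [hv] at s0 s1
  have HH : ∫ x in S, H x ≤ ∫ x in S, h x ^ 2 := by
    rw [hH, setIntegral_indicator mT]
    have e : ∫ x in S ∩ T, h (x + v) ^ 2 ≤ ∫ x in T, h (x + v) ^ 2 := by
      refine setIntegral_mono_set ?_ (Filter.Eventually.of_forall fun x => sq_nonneg _)
        (Filter.Eventually.of_forall Set.inter_subset_right)
      have : IsFiniteMeasure (volume.restrict T) :=
        ⟨by rw [Measure.restrict_apply_univ, hT]; exact (measure_preimage_add_right volume v S).trans_lt (lt_top_iff_ne_top.2 hSf)⟩
      exact Integrable.of_bound (Measurable.aestronglyMeasurable (by fun_prop)) _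
        (Filter.Eventually.of_forall fun x => hb (x + v))
    refine e.trans (le_of_eq ?_)
    rw [← integral_indicator hSm, ← integral_indicator mT,
      ← integral_add_right_eq_self (μ := volume) (S.indicator fun x => h x ^ 2) v]
    congr 1
  have JJ : ∫ x in S, J x ≤ C2 * r := by
    rw [hJ, setIntegral_indicator mT.compl]
    have := hC2 v
    rw [hv] at this
    have e : S ∩ Tᶜ = {x | x ∈ S ∧ x + v ∉ S} := rfl
    rw [← e] at this
    simpa [Measure.real] using this
  have KG : 0 ≤ K + G := by linarith
  have t1 : 3 * (K + G) / r * ((∫ x in S, sd0 x) + ∫ x in S, sd1 x) ≤ 12 * (K + G) * K * C2 * r := by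
    calc _ ≤ 3 * (K + G) / r * (2 * K * C2 * r ^ 2 + 2 * K * C2 * r ^ 2) :=
          mul_le_mul_of_nonneg_left (add_le_add s0 s1) (by positivity)
      _ = _ := by field_simp; ring
  have t2 : 6 / r ^ 2 * ((∫ x in S, h x ^ 2) + ∫ x in S, H x) ≤ 12 * (∫ x in S, h x ^ 2) / r ^ 2 := by
    calc _ ≤ 6 / r ^ 2 * ((∫ x in S, h x ^ 2) + ∫ x in S, h x ^ 2) :=
          mul_le_mul_of_nonneg_left (by linarith) (by positivity)
      _ = _ := by ring
  have t3 : 4 * G ^ 2 * ∫ x in S, J x ≤ 4 * G ^ 2 * C2 * r := by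
    calc _ ≤ 4 * G ^ 2 * (C2 * r) := mul_le_mul_of_nonneg_left JJ (by positivity)
      _ = _ := by ring
  linarith

/-- signed power -/
def sp (α a : ℝ) : ℝ := if 0 ≤ a then a ^ α else -((-a) ^ α)

lemma sp_neg {α : ℝ} (hα : 0 < α) (a : ℝ) : sp α (-a) = - sp α a := by
  unfold sp
  rcases lt_trichotomy a 0 with h | h | h
  · rw [if_pos (by linarith), if_neg (by linarith)]; ring
  · subst h; simp [Real.zero_rpow hα.ne']
  · rw [if_neg (by linarith), if_pos h.le]; simp

lemma sp_nonneg {α a : ℝ} (ha : 0 ≤ a) : sp α a = a ^ α := if_pos ha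

lemma sp_inv {α : ℝ} (hα : 0 < α) (a : ℝ) : sp (1 / α) (sp α a) = a := by
  have key : ∀ b : ℝ, 0 ≤ b → sp (1 / α) (sp α b) = b := by
    intro b hb
    rw [sp_nonneg hb, sp_nonneg (Real.rpow_nonneg hb _), ← Real.rpow_mul hb]
    rw [mul_one_div_cancel hα.ne', Real.rpow_one]
  rcases le_total 0 a with h | h
  · exact key a h
  · have := key (-a) (by linarith)
    rw [sp_neg hα, sp_neg (by positivity)] at this
    linarith

/-- Hölder constant -/
lemma sp_holder_nonneg {α M : ℝ} (hα : 0 < α) (hM : 1 ≤ M) {a b : ℝ} (hb : 0 ≤ b) (hab : b ≤ a)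
    (ha : a ≤ M) : a ^ α - b ^ α ≤ (2 + α * M ^ α) * (a - b) ^ (min α 1) := by
  have h1 : 0 ≤ a - b := by linarith
  have hP : 0 ≤ (a - b) ^ (min α 1) := Real.rpow_nonneg h1 _
  have hMα : 0 < M ^ α := Real.rpow_pos_of_pos (by linarith) _
  rcases le_total α 1 with h | h
  · rw [min_eq_left h] at hP ⊢
    have := Real.rpow_add_le_add_rpow h1 hb hα.le h
    rw [sub_add_cancel] at this
    nlinarith [mul_nonneg (mul_nonneg hα.le hMα.le) hP]
  · rw [min_eq_right h, Real.rpow_one]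
    rcases eq_or_lt_of_le hab with he | hlt
    · subst he; simp
    obtain ⟨c, hc, hc'⟩ := exists_hasDerivAt_eq_slope (fun x : ℝ => x ^ α) (fun x => α * x ^ (α - 1)) hlt
      (fun x _ => (Real.continuousAt_rpow_const x α (Or.inr hα.le)).continuousWithinAt)
      (fun x _ => Real.hasDerivAt_rpow_const (Or.inr h))
    have hpos : 0 < a - b := by linarith
    rw [eq_div_iff hpos.ne'] at hc'
    rw [← hc']
    have hc1 : c ^ (α - 1) ≤ M ^ α := by
      calc c ^ (α - 1) ≤ M ^ (α - 1) := Real.rpow_le_rpow (by linarith [hc.1]) (by linarith [hc.2]) (by linarith)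
        _ ≤ M ^ α := Real.rpow_le_rpow_of_exponent_le hM (by linarith)
    refine mul_le_mul_of_nonneg_right ?_ h1
    nlinarith

lemma sp_holder {α M : ℝ} (hα : 0 < α) (hM : 1 ≤ M) {a b : ℝ} (ha : |a| ≤ M) (hb : |b| ≤ M) :
    |sp α a - sp α b| ≤ 2 * (2 + α * M ^ α) * |a - b| ^ (min α 1) := by
  have hMα : 0 < M ^ α := Real.rpow_pos_of_pos (by linarith) _
  have hC : 0 ≤ 2 + α * M ^ α := by positivity
  have hm : 0 < min α 1 := lt_min hα one_pos
  -- same sign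
  have S : ∀ a b : ℝ, 0 ≤ b → b ≤ a → a ≤ M →
      |sp α a - sp α b| ≤ 2 * (2 + α * M ^ α) * |a - b| ^ (min α 1) := by
    intro a b hb hab ha
    have := sp_holder_nonneg hα hM hb hab ha
    have hmono : b ^ α ≤ a ^ α := Real.rpow_le_rpow hb hab hα.le
    rw [sp_nonneg hb, sp_nonneg (hb.trans hab), abs_of_nonneg (by linarith), abs_of_nonneg (by linarith)]
    have hP : 0 ≤ (a - b) ^ (min α 1) := Real.rpow_nonneg (by linarith) _
    nlinarith [mul_nonneg hC hP]
  have S' : ∀ a b : ℝ, 0 ≤ a → 0 ≤ b → a ≤ M → b ≤ M →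
      |sp α a - sp α b| ≤ 2 * (2 + α * M ^ α) * |a - b| ^ (min α 1) := by
    intro a b ha hb haM hbM
    rcases le_total a b with h | h
    · rw [abs_sub_comm, abs_sub_comm a b]; exact S b a ha h hbM
    · exact S a b hb h haM
  -- opposite signs
  have O : ∀ a b : ℝ, 0 ≤ a → b ≤ 0 → a ≤ M → -b ≤ M →
      |sp α a - sp α b| ≤ 2 * (2 + α * M ^ α) * |a - b| ^ (min α 1) := by
    intro a b ha hb haM hbM
    have h1 := sp_holder_nonneg hα hM le_rfl ha haM
    have h2 := sp_holder_nonneg hα hM le_rfl (show 0 ≤ -b by linarith) hbM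
    rw [Real.zero_rpow hα.ne', sub_zero, sub_zero] at h1 h2
    have e : sp α b = -((-b) ^ α) := by
      have := sp_neg hα (-b)
      rw [neg_neg, sp_nonneg (a := -b) (by linarith)] at this
      exact this
    have p1 : 0 ≤ a ^ α := Real.rpow_nonneg ha _
    have p2 : 0 ≤ (-b) ^ α := Real.rpow_nonneg (by linarith) _
    rw [sp_nonneg ha, e, sub_neg_eq_add, abs_of_nonneg (by linarith), abs_of_nonneg (by linarith)]
    have q1 : a ^ (min α 1) ≤ (a - b) ^ (min α 1) := Real.rpow_le_rpow ha (by linarith) hm.le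
    have q2 : (-b) ^ (min α 1) ≤ (a - b) ^ (min α 1) := Real.rpow_le_rpow (by linarith) (by linarith) hm.le
    nlinarith [mul_le_mul_of_nonneg_left q1 hC, mul_le_mul_of_nonneg_left q2 hC]
  have ha' := abs_le.1 ha
  have hb' := abs_le.1 hb
  rcases le_total 0 a with h | h <;> rcases le_total 0 b with h' | h'
  · exact S' a b h h' ha'.2 hb'.2
  · exact O a b h h' ha'.2 (by linarith)
  · rw [abs_sub_comm, abs_sub_comm a b]; exact O b a h' h hb'.2 (by linarith)
  · have := S' (-a) (-b) (by linarith) (by linarith) (by linarith) (by linarith)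
    rw [sp_neg hα, sp_neg hα] at this
    have e1 : -sp α a - -sp α b = -(sp α a - sp α b) := by ring
    have e2 : -a - -b = -(a - b) := by ring
    rwa [e1, e2, abs_neg, abs_neg] at this

/-- derivative of `|a|^p` -/
def gp (p a : ℝ) : ℝ := p * |a| ^ (p - 2) * a

lemma gp_eq {p : ℝ} (hp : 1 < p) (a : ℝ) : gp p a = p * sp (p - 1) a := by
  unfold gp sp
  rcases lt_trichotomy a 0 with h | h | h
  · rw [if_neg (by linarith), abs_of_neg h]
    have : (-a) ^ (p - 1) = (-a) ^ (p - 2) * (-a) := by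
      rw [← Real.rpow_add_one (by linarith)]; congr 1; ring
    rw [this]; ring
  · subst h; simp [Real.zero_rpow (show p - 1 ≠ 0 by linarith)]
  · rw [if_pos h.le, abs_of_pos h]
    have : a ^ (p - 1) = a ^ (p - 2) * a := by
      rw [← Real.rpow_add_one h.ne']; congr 1; ring
    rw [this]; ring

lemma gp_meas (p : ℝ) : Measurable (gp p) := by
  unfold gp
  have : Measurable (fun a : ℝ => |a| ^ (p - 2)) := by
    have h1 : Measurable (fun a : ℝ => |a|) := measurable_norm
    exact h1.pow_const _
  fun_prop

lemma gp_holder {p M : ℝ} (hp : 1 < p) (hM : 1 ≤ M) : ∃ C, 0 ≤ C ∧ ∀ a b : ℝ, |a| ≤ M → |b| ≤ M →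
    |gp p a - gp p b| ≤ C * |a - b| ^ (min p 2 - 1) := by
  refine ⟨p * (2 * (2 + (p - 1) * M ^ (p - 1))), ?_, ?_⟩
  · have : 0 < M ^ (p - 1) := Real.rpow_pos_of_pos (by linarith) _
    have : 0 < p - 1 := by linarith
    positivity
  · intro a b ha hb
    have := sp_holder (show 0 < p - 1 by linarith) hM ha hb
    have e : min (p - 1) 1 = min p 2 - 1 := by
      rw [show (1 : ℝ) = 2 - 1 by norm_num, ← min_sub_sub_right]; norm_num
    rw [e] at this
    rw [gp_eq hp, gp_eq hp, ← mul_sub, abs_mul, abs_of_pos (by linarith), mul_assoc]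
    exact mul_le_mul_of_nonneg_left this (by linarith)

lemma gp_bound {p M : ℝ} (hp : 1 < p) (hM : 1 ≤ M) {a : ℝ} (ha : |a| ≤ M) : |gp p a| ≤ p * M ^ (p - 1) := by
  unfold gp
  rcases eq_or_ne a 0 with h | h
  · subst h
    simp only [mul_zero, abs_zero]
    have : 0 < M ^ (p - 1) := Real.rpow_pos_of_pos (by linarith) _
    positivity
  · have h0 : 0 < |a| := abs_pos.2 h
    have : |a| ^ (p - 1) = |a| ^ (p - 2) * |a| := by
      rw [← Real.rpow_add_one h0.ne']; congr 1; ring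
    rw [abs_mul, abs_mul, abs_of_pos (show 0 < p by linarith), abs_of_nonneg (Real.rpow_nonneg h0.le _),
      mul_assoc, ← this]
    exact mul_le_mul_of_nonneg_left (Real.rpow_le_rpow h0.le ha (by linarith)) (by linarith)

/-- inverse Hölder estimate -/
lemma gp_inv_holder {p M : ℝ} (hp : 1 < p) (hM : 1 ≤ M) : ∃ C, 0 ≤ C ∧ ∀ a b : ℝ, |a| ≤ M → |b| ≤ M →
    |a - b| ≤ C * |gp p a - gp p b| ^ (min (1 / (p - 1)) 1) := by
  set N := M ^ (p - 1) with hN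
  have p1 : 0 < p - 1 := by linarith
  have N1 : 1 ≤ N := Real.one_le_rpow hM p1.le
  have hb : 0 < min (1 / (p - 1)) 1 := lt_min (by positivity) one_pos
  refine ⟨2 * (2 + (1 / (p - 1)) * N ^ (1 / (p - 1))), ?_, ?_⟩
  · have : 0 < N ^ (1 / (p - 1)) := Real.rpow_pos_of_pos (by linarith) _
    positivity
  · intro a b ha hb'
    have bd : ∀ a : ℝ, |a| ≤ M → |sp (p - 1) a| ≤ N := by
      intro a ha
      have := gp_bound hp hM ha
      rw [gp_eq hp, abs_mul, abs_of_pos (by linarith)] at this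
      exact le_of_mul_le_mul_left this (by linarith)
    have := sp_holder (α := 1 / (p - 1)) (by positivity) N1 (bd a ha) (bd b hb')
    rw [sp_inv p1, sp_inv p1] at this
    refine this.trans (mul_le_mul_of_nonneg_left ?_ ?_)
    · refine Real.rpow_le_rpow (abs_nonneg _) ?_ hb.le
      rw [gp_eq hp, gp_eq hp, ← mul_sub, abs_mul, abs_of_pos (show 0 < p by linarith)]
      exact le_mul_of_one_le_left (abs_nonneg _) hp.le
    · have : 0 < N ^ (1 / (p - 1)) := Real.rpow_pos_of_pos (by linarith) _
      positivity

lemma abs_rpow_mvt {p : ℝ} (hp : 1 < p) (a r : ℝ) : ∃ ξ, |ξ - a| ≤ |r| ∧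
    |a + r| ^ p - |a| ^ p = gp p ξ * r := by
  have hd : ∀ x : ℝ, HasDerivAt (fun x : ℝ => |x| ^ p) (gp p x) x := fun x => hasDerivAt_abs_rpow x hp
  rcases lt_trichotomy r 0 with h | h | h
  · obtain ⟨c, hc, hc'⟩ := exists_hasDerivAt_eq_slope (fun x : ℝ => |x| ^ p) (gp p) (show a + r < a by linarith)
      (fun x _ => (hd x).continuousAt.continuousWithinAt) (fun x _ => hd x)
    refine ⟨c, ?_, ?_⟩
    · rw [abs_of_neg h, abs_le]; constructor <;> linarith [hc.1, hc.2]
    · rw [hc']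
      have : a - (a + r) = -r := by ring
      have hr := h.ne
      rw [this, div_neg, neg_mul, div_mul_cancel₀ _ hr]; ring
  · subst h; exact ⟨a, by simp, by simp⟩
  · obtain ⟨c, hc, hc'⟩ := exists_hasDerivAt_eq_slope (fun x : ℝ => |x| ^ p) (gp p) (show a < a + r by linarith)
      (fun x _ => (hd x).continuousAt.continuousWithinAt) (fun x _ => hd x)
    refine ⟨c, ?_, ?_⟩
    · rw [abs_of_pos h, abs_le]; constructor <;> linarith [hc.1, hc.2]
    · rw [hc']
      have : a + r - a = r := by ring
      rw [this]; field_simp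

lemma abs_rpow_taylor {p M : ℝ} (hp : 1 < p) (hM : 1 ≤ M) : ∃ C, 0 ≤ C ∧ ∀ a r : ℝ, |a| ≤ M → |r| ≤ M →
    |a + r| ^ p ≤ |a| ^ p + gp p a * r + C * |r| ^ (min p 2) := by
  obtain ⟨C, hC, h⟩ := gp_holder hp (show 1 ≤ 2 * M by linarith)
  refine ⟨C, hC, fun a r ha hr => ?_⟩
  obtain ⟨ξ, h1, h2⟩ := abs_rpow_mvt hp a r
  have hξ : |ξ| ≤ 2 * M := by
    have := abs_add_le (ξ - a) a
    rw [sub_add_cancel] at this; linarith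
  have h3 := h ξ a hξ (by linarith)
  have m1 : 0 ≤ min p 2 - 1 := by
    have : 1 ≤ min p 2 := le_min hp.le (by norm_num)
    linarith
  have h4 : |gp p ξ - gp p a| ≤ C * |r| ^ (min p 2 - 1) :=
    h3.trans (mul_le_mul_of_nonneg_left (Real.rpow_le_rpow (abs_nonneg _) h1 m1) hC)
  rcases eq_or_ne r 0 with h0 | h0
  · subst h0; simp only [add_zero, mul_zero]
    have : 0 ≤ C * |(0:ℝ)| ^ (min p 2) := mul_nonneg hC (Real.rpow_nonneg (abs_nonneg _) _)
    linarith
  have r0 : 0 < |r| := abs_pos.2 h0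
  have h5 : |r| ^ (min p 2) = |r| ^ (min p 2 - 1) * |r| := by
    rw [← Real.rpow_add_one r0.ne']; congr 1; ring
  have h6 : (gp p ξ - gp p a) * r ≤ C * |r| ^ (min p 2 - 1) * |r| := by
    refine (le_abs_self _).trans ?_
    rw [abs_mul]
    exact mul_le_mul_of_nonneg_right h4 r0.le
  rw [h5]
  nlinarith

lemma abs_rpow_mid {p M : ℝ} (hp : 1 < p) (hM : 1 ≤ M) : ∃ C, 0 ≤ C ∧ ∀ a b : ℝ, |a| ≤ M → |b| ≤ M →
    ∀ ε, 0 < ε → (|a| ^ p + |b| ^ p) / 2 ≤ |(a + b) / 2| ^ p +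
      C * (ε ^ (min p 2 - 2) * ((a - b) ^ 2 / 4) + ε ^ (min p 2)) := by
  obtain ⟨C, hC, h⟩ := abs_rpow_taylor hp hM
  refine ⟨C, hC, fun a b ha hb ε hε => ?_⟩
  have ha' := abs_le.1 ha
  have hb' := abs_le.1 hb
  have h1 := h ((a + b) / 2) ((a - b) / 2) (abs_le.2 ⟨by linarith, by linarith⟩) (abs_le.2 ⟨by linarith, by linarith⟩)
  have h2 := h ((a + b) / 2) (-((a - b) / 2)) (abs_le.2 ⟨by linarith, by linarith⟩) (abs_le.2 ⟨by linarith, by linarith⟩)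
  rw [show (a + b) / 2 + (a - b) / 2 = a by ring] at h1
  rw [show (a + b) / 2 + -((a - b) / 2) = b by ring, abs_neg] at h2
  have m2 : min p 2 - 2 ≤ 0 := by linarith [min_le_right p 2]
  have m0 : 0 < min p 2 := lt_min (by linarith) (by norm_num)
  have key : |(a - b) / 2| ^ (min p 2) ≤ ε ^ (min p 2 - 2) * ((a - b) ^ 2 / 4) + ε ^ (min p 2) := by
    have p1 : 0 < ε ^ (min p 2 - 2) := Real.rpow_pos_of_pos hε _
    have p2 : 0 < ε ^ (min p 2) := Real.rpow_pos_of_pos hε _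
    rcases le_total |(a - b) / 2| ε with hle | hle
    · have := Real.rpow_le_rpow (abs_nonneg _) hle m0.le
      nlinarith [mul_nonneg p1.le (sq_nonneg (a - b))]
    · have r0 : 0 < |(a - b) / 2| := lt_of_lt_of_le hε hle
      have e : |(a - b) / 2| ^ (min p 2) = |(a - b) / 2| ^ (min p 2 - 2) * ((a - b) ^ 2 / 4) := by
        have : (a - b) ^ 2 / 4 = |(a - b) / 2| ^ (2 : ℝ) := by
          rw [Real.rpow_two, sq_abs]; ring
        rw [this, ← Real.rpow_add r0]; congr 1; ring
      have := Real.rpow_le_rpow_of_nonpos hε hle m2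
      rw [e]
      nlinarith [mul_le_mul_of_nonneg_right this (show 0 ≤ (a - b) ^ 2 / 4 by positivity)]
  have := mul_le_mul_of_nonneg_left key hC
  linarith

lemma pow_split {b A t : ℝ} (hb0 : 0 < b) (hb : b ≤ 1) (hA : 0 < A) (ht : 0 ≤ t) :
    t ^ b ≤ A ^ b + A ^ (b - 1) * t := by
  have p1 : 0 < A ^ (b - 1) := Real.rpow_pos_of_pos hA _
  rcases le_total t A with h | h
  · have := Real.rpow_le_rpow ht h hb0.le
    nlinarith [mul_nonneg p1.le ht]
  · have t0 : 0 < t := lt_of_lt_of_le hA h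
    have e : t ^ b = t ^ (b - 1) * t := by rw [← Real.rpow_add_one t0.ne']; congr 1; ring
    have := Real.rpow_le_rpow_of_nonpos hA h (show b - 1 ≤ 0 by linarith)
    have q : 0 < A ^ b := Real.rpow_pos_of_pos hA _
    rw [e]
    nlinarith [mul_le_mul_of_nonneg_right this ht]

/-- clamp to `[-R,R]` -/
def clp (R t : ℝ) : ℝ := max (-R) (min t R)

lemma clp_lip (R s t : ℝ) : |clp R s - clp R t| ≤ |s - t| := by
  unfold clp
  refine (abs_max_sub_max_le_max _ _ _ _).trans ?_
  rw [sub_self, abs_zero]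
  refine max_le (abs_nonneg _) ((abs_min_sub_min_le_max _ _ _ _).trans ?_)
  simp

lemma clp_abs {R : ℝ} (hR : 0 ≤ R) (t : ℝ) : |clp R t| ≤ R := by
  unfold clp
  rw [abs_le]
  exact ⟨le_max_left _ _, max_le (by linarith) (min_le_right _ _)⟩

lemma clp_eq {R t : ℝ} (h : |t| ≤ R) : clp R t = t := by
  unfold clp
  have := abs_le.1 h
  rw [min_eq_left this.2, max_eq_right this.1]

lemma clp_sub_abs {R : ℝ} (hR : 0 ≤ R) (s t : ℝ) : |clp R s - clp R t| ≤ 2 * R :=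
  (abs_sub _ _).trans (by linarith [clp_abs hR s, clp_abs hR t])

/-- clamped cost -/
def cc {d : ℕ} (p R : ℝ) (x y : Fin d → ℝ) : ℝ := ∑ i, |clp R (x i) - clp R (y i)| ^ p

lemma cc_nonneg {d : ℕ} (p R : ℝ) (x y : Fin d → ℝ) : 0 ≤ cc p R x y :=
  Finset.sum_nonneg fun _ _ => Real.rpow_nonneg (abs_nonneg _) _

lemma cc_comm {d : ℕ} (p R : ℝ) (x y : Fin d → ℝ) : cc p R x y = cc p R y x := by
  unfold cc; simp only [abs_sub_comm]

lemma coord_le {d : ℕ} {x : Fin d → ℝ} {R : ℝ} (h : ‖x‖ ≤ R) (i : Fin d) : |x i| ≤ R :=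
  (norm_le_pi_norm x i).trans h

lemma cc_eq {d : ℕ} {p R : ℝ} {x y : Fin d → ℝ} (hx : ‖x‖ ≤ R) (hy : ‖y‖ ≤ R) :
    cc p R x y = ∑ i, |x i - y i| ^ p := by
  unfold cc
  refine Finset.sum_congr rfl fun i _ => ?_
  rw [clp_eq (coord_le hx i), clp_eq (coord_le hy i)]

lemma cc_meas {d : ℕ} (p R : ℝ) : Measurable (fun z : (Fin d → ℝ) × (Fin d → ℝ) => cc p R z.1 z.2) := by
  unfold cc clp
  refine Finset.measurable_sum _ fun i _ => ?_
  have h1 : Measurable (fun z : (Fin d → ℝ) × (Fin d → ℝ) =>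
      max (-R) (min (z.1 i) R) - max (-R) (min (z.2 i) R)) := by fun_prop
  exact (h1.norm).pow_const p

lemma cc_consts (d : ℕ) {p R : ℝ} (hp : 1 < p) (hR : 1 ≤ R) : ∃ K, 1 ≤ K ∧
    (∀ x y : Fin d → ℝ, |cc p R x y| ≤ K) ∧
    (∀ x y x' y' : Fin d → ℝ, |cc p R x y - cc p R x' y'| ≤ K * (dist x x' + dist y y')) := by
  have hM : 1 ≤ 2 * R := by linarith
  have q1 : 0 < (2 * R) ^ p := Real.rpow_pos_of_pos (by linarith) _
  have q2 : 0 < (6 * R) ^ (p - 1) := Real.rpow_pos_of_pos (by linarith) _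
  have hd : (0:ℝ) ≤ d := Nat.cast_nonneg d
  refine ⟨1 + d * (2 * R) ^ p + d * (p * (6 * R) ^ (p - 1)), ?_, ?_, ?_⟩
  · have : 0 ≤ d * (2 * R) ^ p := by positivity
    have : 0 ≤ d * (p * (6 * R) ^ (p - 1)) := by positivity
    linarith
  · intro x y
    rw [abs_of_nonneg (cc_nonneg _ _ _ _)]
    have : cc p R x y ≤ d * (2 * R) ^ p := by
      unfold cc
      refine (Finset.sum_le_card_nsmul _ _ ((2 * R) ^ p) fun i _ =>
        Real.rpow_le_rpow (abs_nonneg _) (clp_sub_abs (by linarith) _ _) (by linarith)).trans ?_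
      simp
    have : 0 ≤ d * (p * (6 * R) ^ (p - 1)) := by positivity
    linarith
  · intro x y x' y'
    have D0 : 0 ≤ dist x x' + dist y y' := by positivity
    have : |cc p R x y - cc p R x' y'| ≤ d * (p * (6 * R) ^ (p - 1) * (dist x x' + dist y y')) := by
      unfold cc
      rw [← Finset.sum_sub_distrib]
      refine (Finset.abs_sum_le_sum_abs _ _).trans ?_
      refine (Finset.sum_le_card_nsmul _ _ (p * (6 * R) ^ (p - 1) * (dist x x' + dist y y')) fun i _ => ?_).trans ?_
      · set a := clp R (x i) - clp R (y i) with ha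
        set b := clp R (x' i) - clp R (y' i) with hb
        obtain ⟨ξ, h1, h2⟩ := abs_rpow_mvt hp b (a - b)
        rw [show b + (a - b) = a by ring] at h2
        rw [h2, abs_mul]
        have hA : |a| ≤ 2 * R := clp_sub_abs (by linarith) _ _
        have hB : |b| ≤ 2 * R := clp_sub_abs (by linarith) _ _
        have hξ : |ξ| ≤ 6 * R := by
          have := abs_add_le (ξ - b) b
          rw [sub_add_cancel] at this
          have := abs_sub a b
          linarith
        refine mul_le_mul (gp_bound hp (by linarith) hξ) ?_ (abs_nonneg _) (by positivity)
        have e : a - b = (clp R (x i) - clp R (x' i)) - (clp R (y i) - clp R (y' i)) := by rw [ha, hb]; ring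
        rw [e]
        refine (abs_sub _ _).trans (add_le_add ((clp_lip _ _ _).trans ?_) ((clp_lip _ _ _).trans ?_))
        · exact dist_le_pi_dist x x' i
        · exact dist_le_pi_dist y y' i
      · simp
    have : 0 ≤ d * (2 * R) ^ p := by positivity
    nlinarith

lemma mid_norm {d : ℕ} {R : ℝ} {x y : Fin d → ℝ} (hx : ‖x‖ ≤ R) (hy : ‖y‖ ≤ R) :
    ‖(1/2 : ℝ) • (x + y)‖ ≤ R := by
  rw [norm_smul]
  have := norm_add_le x y
  norm_num; linarith

lemma cc_mid (d : ℕ) {p R : ℝ} (hp : 1 < p) (hR : 1 ≤ R) : ∃ C, 1 ≤ C ∧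
    ∀ x y z : Fin d → ℝ, ‖x‖ ≤ R → ‖y‖ ≤ R → ∀ ε, 0 < ε →
      (cc p R x z + cc p R y z) / 2 ≤ cc p R ((1/2 : ℝ) • (x + y)) z +
        C * (ε ^ (min p 2 - 2) * (nsq (x - y) / 4)) + C * (d * ε ^ (min p 2)) := by
  obtain ⟨C, hC, h⟩ := abs_rpow_mid hp (show 1 ≤ 2 * R by linarith)
  refine ⟨C + 1, by linarith, fun x y z hx hy ε hε => ?_⟩
  have p1 : 0 < ε ^ (min p 2 - 2) := Real.rpow_pos_of_pos hε _
  have p2 : 0 < ε ^ (min p 2) := Real.rpow_pos_of_pos hε _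
  have main : (cc p R x z + cc p R y z) / 2 ≤ cc p R ((1/2 : ℝ) • (x + y)) z +
        C * (ε ^ (min p 2 - 2) * (nsq (x - y) / 4) + d * ε ^ (min p 2)) := by
    have e : C * (ε ^ (min p 2 - 2) * (nsq (x - y) / 4) + d * ε ^ (min p 2)) =
        ∑ i : Fin d, C * (ε ^ (min p 2 - 2) * ((x i - y i) ^ 2 / 4) + ε ^ (min p 2)) := by
      rw [← Finset.mul_sum, Finset.sum_add_distrib, ← Finset.mul_sum, ← Finset.sum_div]
      simp [nsq]
    rw [e]
    unfold cc
    rw [← Finset.sum_add_distrib, Finset.sum_div, ← Finset.sum_add_distrib]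
    refine Finset.sum_le_sum fun i _ => ?_
    have hm := mid_norm hx hy
    have ex := clp_eq (coord_le hx i)
    have ey := clp_eq (coord_le hy i)
    have em := clp_eq (coord_le hm i)
    have bx := clp_sub_abs (show 0 ≤ R by linarith) (x i) (z i)
    have by' := clp_sub_abs (show 0 ≤ R by linarith) (y i) (z i)
    rw [ex] at bx
    rw [ey] at by'
    rw [ex, ey, em]
    have := h (x i - clp R (z i)) (y i - clp R (z i)) bx by' ε hε
    have e1 : (x i - clp R (z i) + (y i - clp R (z i))) / 2 = ((1/2 : ℝ) • (x + y)) i - clp R (z i) := by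
      simp only [Pi.smul_apply, Pi.add_apply, smul_eq_mul]; ring
    have e2 : x i - clp R (z i) - (y i - clp R (z i)) = x i - y i := by ring
    rw [e1, e2] at this
    exact this
  have n0 := nsq_nonneg (x - y)
  have : 0 ≤ ε ^ (min p 2 - 2) * (nsq (x - y) / 4) := by positivity
  have : 0 ≤ (d:ℝ) * ε ^ (min p 2) := by positivity
  nlinarith

lemma cc_shift (d : ℕ) {p R : ℝ} (hp : 1 < p) (hR : 1 ≤ R) : ∃ C, 0 ≤ C ∧
    ∀ (x z : Fin d → ℝ) (i : Fin d) (s : ℝ), ‖x‖ ≤ R - 1 → ‖z‖ ≤ R → |s| ≤ 1 →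
      cc p R (x + Pi.single i s) z ≤ cc p R x z + gp p (x i - z i) * s + C * |s| ^ (min p 2) := by
  obtain ⟨C, hC, h⟩ := abs_rpow_taylor hp (show 1 ≤ 2 * R by linarith)
  refine ⟨C, hC, fun x z i s hx hz hs => ?_⟩
  have hxs : ‖x + Pi.single i s‖ ≤ R := by
    refine (norm_add_le _ _).trans ?_
    have : ‖(Pi.single i s : Fin d → ℝ)‖ = |s| := by
      rw [Pi.norm_single]; rfl
    rw [this]; linarith
  have hx' : ‖x‖ ≤ R := by linarith
  rw [cc_eq hxs hz, cc_eq hx' hz]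
  rw [← Finset.add_sum_erase _ _ (Finset.mem_univ i), ← Finset.add_sum_erase _ (fun j => |x j - z j| ^ p) (Finset.mem_univ i)]
  have e : ∑ j ∈ Finset.univ.erase i, |(x + (Pi.single i s : Fin d → ℝ)) j - z j| ^ p = ∑ j ∈ Finset.univ.erase i, |x j - z j| ^ p := by
    refine Finset.sum_congr rfl fun j hj => ?_
    rw [Pi.add_apply, Pi.single_eq_of_ne (Finset.ne_of_mem_erase hj), add_zero]
  rw [e]
  have := h (x i - z i) s ((abs_sub _ _).trans (by linarith [coord_le hx' i, coord_le hz i])) (by linarith)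
  rw [Pi.add_apply, Pi.single_eq_same, show x i + s - z i = x i - z i + s by ring]
  linarith

lemma meas_of_lip {d : ℕ} {φ : (Fin d → ℝ) → ℝ} {K : ℝ} (hK : 0 ≤ K)
    (h : ∀ x y, |φ x - φ y| ≤ K * dist x y) : Measurable φ := by
  have : LipschitzWith K.toNNReal φ := LipschitzWith.of_dist_le_mul fun x y => by
    rw [Real.coe_toNNReal _ hK]; exact h x y
  exact this.continuous.measurable

/-- `φ, ψ` are potentials adapted to the map `T`. -/
def Pot {d : ℕ} (p R K : ℝ) (U : Set (Fin d → ℝ)) (φ ψ : (Fin d → ℝ) → ℝ)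
    (T : (Fin d → ℝ) → (Fin d → ℝ)) : Prop :=
  (∀ x y, 0 ≤ φ x + ψ y + cc p R x y) ∧
  (∀ᵐ x ∂(volume.restrict U), ‖T x‖ ≤ R ∧ φ x + ψ (T x) + cc p R x (T x) = 0) ∧
  (∀ x, |φ x| ≤ 4 * K) ∧ (∀ x, |ψ x| ≤ 4 * K) ∧
  (∀ x y, |φ x - φ y| ≤ K * dist x y) ∧ (∀ x y, |ψ x - ψ y| ≤ K * dist x y) ∧ Measurable T

lemma pot_dq {d : ℕ} {p R K C r : ℝ} {U : Set (Fin d → ℝ)} (Um : MeasurableSet U)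
    (hU : ∀ x ∈ U, ‖x‖ ≤ R - 1)
    (hC : ∀ (x z : Fin d → ℝ) (i : Fin d) (s : ℝ), ‖x‖ ≤ R - 1 → ‖z‖ ≤ R → |s| ≤ 1 →
      cc p R (x + Pi.single i s) z ≤ cc p R x z + gp p (x i - z i) * s + C * |s| ^ (min p 2))
    {φ ψ : (Fin d → ℝ) → ℝ} {T : (Fin d → ℝ) → (Fin d → ℝ)} (h : Pot p R K U φ ψ T)
    (i : Fin d) (hr : 0 < r) (hr1 : r ≤ 1) :
    ∀ᵐ x ∂(volume.restrict U), φ x + r * (-gp p (x i - T x i)) - C * r * r ^ (min p 2 - 1) ≤ φ (x + Pi.single i r) ∧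
      φ x - r * (-gp p (x i - T x i)) - C * r * r ^ (min p 2 - 1) ≤ φ (x - Pi.single i r) := by
  obtain ⟨h1, h2, -⟩ := h
  filter_upwards [h2, ae_restrict_mem Um] with x hx hxU
  have e : C * r * r ^ (min p 2 - 1) = C * r ^ (min p 2) := by
    have : r ^ (min p 2) = r ^ (min p 2 - 1) * r := by
      rw [← Real.rpow_add_one hr.ne']; congr 1; ring
    rw [this]; ring
  rw [e]
  have a1 := hC x (T x) i r (hU x hxU) hx.1 (by rw [abs_of_pos hr]; exact hr1)
  have a2 := hC x (T x) i (-r) (hU x hxU) hx.1 (by rw [abs_neg, abs_of_pos hr]; exact hr1)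
  rw [abs_of_pos hr] at a1
  rw [abs_neg, abs_of_pos hr, Pi.single_neg, ← sub_eq_add_neg] at a2
  have b1 := h1 (x + Pi.single i r) (T x)
  have b2 := h1 (x - Pi.single i r) (T x)
  constructor <;> nlinarith [hx.2]

lemma nsq_mid {d : ℕ} (x y : Fin d → ℝ) :
    nsq ((1/2 : ℝ) • (x + y)) = nsq x / 2 + nsq y / 2 - nsq (x - y) / 4 := by
  unfold nsq
  rw [Finset.sum_div, Finset.sum_div, Finset.sum_div, ← Finset.sum_add_distrib, ← Finset.sum_sub_distrib]
  refine Finset.sum_congr rfl fun i _ => ?_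
  simp only [Pi.smul_apply, Pi.add_apply, Pi.sub_apply, smul_eq_mul]; ring

lemma nsq_le {d : ℕ} {R : ℝ} {x : Fin d → ℝ} (h : ‖x‖ ≤ R) : nsq x ≤ d * R ^ 2 := by
  unfold nsq
  refine (Finset.sum_le_card_nsmul _ _ (R ^ 2) fun i _ => ?_).trans (by simp)
  exact sq_le_sq' (by linarith [(abs_le.1 (coord_le h i)).1]) (abs_le.1 (coord_le h i)).2

/-- L² control of the potentials -/
lemma core0 (d : ℕ) {p R : ℝ} (hp : 1 < p) (hR : 1 ≤ R) {U : Set (Fin d → ℝ)} (Um : MeasurableSet U)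
    (Uc : Convex ℝ U) (Uf : volume U ≠ ∞) (U0 : volume U ≠ 0) (hU : ∀ x ∈ U, ‖x‖ ≤ R - 1)
    {K : ℝ} (hK : 1 ≤ K) (hcb : ∀ x y : Fin d → ℝ, |cc p R x y| ≤ K)
    (hcL : ∀ x y x' y' : Fin d → ℝ, |cc p R x y - cc p R x' y'| ≤ K * (dist x x' + dist y y'))
    {Λ : ℝ} (hΛ : 0 ≤ Λ) :
    ∃ C, 0 ≤ C ∧ ∀ φ0 ψ0 T0 φ1 ψ1 T1, Pot p R K U φ0 ψ0 T0 → Pot p R K U φ1 ψ1 T1 →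
      ∀ w, 0 < w → w ≤ 1 →
      ∫ x in U, (φ0 x + φ1 x - 2 * ctr (cc p R) (fun z => (ψ0 z + ψ1 z) / 2) x) ≤ Λ * w →
      ∃ a, ∫ x in U, (φ1 x - φ0 x - a) ^ 2 ≤ C * w ^ (2 * (min p 2 - 1) / min p 2) := by
  obtain ⟨Cm, hCm, hmid⟩ := cc_mid d hp hR
  have m1 : 1 < min p 2 := lt_min hp (by norm_num)
  have m2 : min p 2 ≤ 2 := min_le_right _ _
  set m := min p 2 with hm
  have hd : (0:ℝ) ≤ d := Nat.cast_nonneg d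
  set B := 5 * K + Cm * d with hB
  have Cd : 0 ≤ Cm * d := by positivity
  set V1 := 128 * B * Real.exp (2 * (1 + d * R ^ 2)) * (1 + (volume U).toReal) with hV1
  have V0 : 0 ≤ (volume U).toReal := ENNReal.toReal_nonneg
  have V10 : 0 ≤ V1 := by
    have : 0 ≤ B := by linarith
    positivity
  refine ⟨V1 * Cm * (Λ + Cm * d), by positivity, ?_⟩
  intro φ0 ψ0 T0 φ1 ψ1 T1 P0 P1 w w0 w1 hw
  obtain ⟨f0, -, bφ0, bψ0, lφ0, lψ0, -⟩ := P0
  obtain ⟨f1, -, bφ1, bψ1, lφ1, lψ1, -⟩ := P1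
  set χ : (Fin d → ℝ) → ℝ := fun z => (ψ0 z + ψ1 z) / 2 with hχ
  have bχ : ∀ z, |χ z| ≤ 4 * K := by
    intro z
    have := abs_le.1 (bψ0 z)
    have := abs_le.1 (bψ1 z)
    rw [abs_le]; simp only [hχ]; constructor <;> linarith
  set g := ctr (cc p R) χ with hg
  have bg : ∀ x, |g x| ≤ 5 * K := fun x => (ctr_abs hcb bχ x).trans (by linarith)
  have lg : ∀ x y, |g x - g y| ≤ K * dist x y := fun x y => ctr_lip hcb hcL bχ x y
  have K0 : 0 ≤ K := by linarith
  set ε := w ^ (1 / m) with hε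
  have ε0 : 0 < ε := Real.rpow_pos_of_pos w0 _
  have εm : ε ^ m = w := by
    rw [hε, ← Real.rpow_mul w0.le, one_div_mul_cancel (by linarith), Real.rpow_one]
  have εm2 : ε ^ (m - 2) = w ^ ((m - 2) / m) := by
    rw [hε, ← Real.rpow_mul w0.le]; congr 1; ring
  have ε1 : 1 ≤ ε ^ (m - 2) := by
    rw [εm2]
    refine Real.one_le_rpow_of_pos_of_le_one_of_nonpos w0 w1 ?_
    exact div_nonpos_of_nonpos_of_nonneg (by linarith) (by linarith)
  obtain ⟨a, -, ha⟩ := var_ineq Um Uc Uf U0 (R := d * R ^ 2) (fun x hx => nsq_le (by linarith [hU x hx]))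
    (meas_of_lip K0 lφ0) (meas_of_lip K0 lφ1) (meas_of_lip K0 lg) (B := B) (by linarith)
    (fun x => (bφ0 x).trans (by linarith)) (fun x => (bφ1 x).trans (by linarith))
    (fun x => (bg x).trans (by linarith))
    (fun x => ctr_le fun z => by
      have h0 := f0 x z
      have h1 := f1 x z
      rw [cc_comm p R z x]
      simp only [hχ]; linarith)
    (L := Cm * ε ^ (m - 2)) (κ := Cm * (d * w)) (by nlinarith) (by positivity)
    (by
      have : Cm * (d * w) ≤ Cm * d := by
        rw [← mul_assoc]; exact mul_le_of_le_one_right Cd w1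
      linarith)
    (by
      intro x hx y hy
      have hxR : ‖x‖ ≤ R := by linarith [hU x hx]
      have hyR : ‖y‖ ≤ R := by linarith [hU y hy]
      have key : g ((1/2 : ℝ) • (x + y)) ≤ (φ0 x + φ1 y) / 2 +
          Cm * (ε ^ (m - 2) * (nsq (x - y) / 4)) + Cm * (d * ε ^ m) := by
        refine ctr_le fun z => ?_
        have h0 := f0 x z
        have h1 := f1 y z
        have h2 := hmid x y z hxR hyR ε ε0
        rw [cc_comm p R z]
        simp only [hχ]
        linarith
      rw [εm] at key
      rw [nsq_mid]
      linarith)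
  refine ⟨a, ha.trans ?_⟩
  have e1 : w ^ (2 * (m - 1) / m) = ε ^ (m - 2) * w := by
    rw [εm2, ← Real.rpow_add_one w0.ne']; congr 1
    field_simp; ring
  rw [e1]
  calc V1 * (Cm * ε ^ (m - 2)) * ((∫ x in U, (φ0 x + φ1 x - 2 * g x)) + Cm * (d * w))
      ≤ V1 * (Cm * ε ^ (m - 2)) * (Λ * w + Cm * (d * w)) := by
        refine mul_le_mul_of_nonneg_left (by linarith) (by positivity)
    _ = _ := by ring

lemma core1 (d : ℕ) {p R : ℝ} (hp : 1 < p) (hR : 1 ≤ R) {U : Set (Fin d → ℝ)} (Um : MeasurableSet U)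
    (Uc : Convex ℝ U) (Uf : volume U ≠ ∞) (U0 : volume U ≠ 0) (hU : ∀ x ∈ U, ‖x‖ ≤ R - 1)
    {x0 : Fin d → ℝ} {η : ℝ} (hη : 0 < η) (hball : Metric.closedBall x0 η ⊆ U)
    {K : ℝ} (hK : 1 ≤ K) (hcb : ∀ x y : Fin d → ℝ, |cc p R x y| ≤ K)
    (hcL : ∀ x y x' y' : Fin d → ℝ, |cc p R x y - cc p R x' y'| ≤ K * (dist x x' + dist y y'))
    {Λ : ℝ} (hΛ : 0 ≤ Λ) :
    ∃ C, 0 ≤ C ∧ ∀ φ0 ψ0 T0 φ1 ψ1 T1, Pot p R K U φ0 ψ0 T0 → Pot p R K U φ1 ψ1 T1 →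
      ∀ w, 0 < w → w ≤ 1 →
      ∫ x in U, (φ0 x + φ1 x - 2 * ctr (cc p R) (fun z => (ψ0 z + ψ1 z) / 2) x) ≤ Λ * w →
      ∀ i, ∫ x in U, (gp p (x i - T0 x i) - gp p (x i - T1 x i)) ^ 2 ≤
        C * w ^ (2 * (min p 2 - 1) ^ 2 / (min p 2 * (min p 2 + 1))) := by
  obtain ⟨V2, hV2, hcore⟩ := core0 d hp hR Um Uc Uf U0 hU hK hcb hcL hΛ
  obtain ⟨C1, hC1, hshift⟩ := cc_shift d hp hR
  set C2 := (d + 1) / η * (volume U).toReal with hC2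
  have hC2' : ∀ v : Fin d → ℝ, (volume {x | x ∈ U ∧ x + v ∉ U}).toReal ≤ C2 * ‖v‖ :=
    fun v => trans_vol Um Uc Uf hη hball v
  have V0 : 0 ≤ (volume U).toReal := ENNReal.toReal_nonneg
  have C20 : 0 ≤ C2 := by positivity
  have m1 : 1 < min p 2 := lt_min hp (by norm_num)
  have m2 : min p 2 ≤ 2 := min_le_right _ _
  set G := p * (2 * R) ^ (p - 1) with hG
  have G0 : 0 ≤ G := by
    have : 0 < (2 * R) ^ (p - 1) := Real.rpow_pos_of_pos (by linarith) _
    positivity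
  have K0 : 0 ≤ K := by linarith
  refine ⟨12 * (K + G) * K * C2 + 18 * (K + G) * C1 * (volume U).toReal + 4 * G ^ 2 * C2 + 12 * V2,
    by positivity, ?_⟩
  intro φ0 ψ0 T0 φ1 ψ1 T1 P0 P1 w w0 w1 hw i
  obtain ⟨a, ha⟩ := hcore φ0 ψ0 T0 φ1 ψ1 T1 P0 P1 w w0 w1 hw
  set r := w ^ (2 * (min p 2 - 1) / (min p 2 * (min p 2 + 1))) with hr
  have ex0 : 0 ≤ 2 * (min p 2 - 1) / (min p 2 * (min p 2 + 1)) :=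
    div_nonneg (by linarith) (by positivity)
  have r0 : 0 < r := Real.rpow_pos_of_pos w0 _
  have r1 : r ≤ 1 := Real.rpow_le_one w0.le w1 ex0
  have d0 := pot_dq Um hU hshift P0 i r0 r1
  have d1 := pot_dq Um hU hshift P1 i r0 r1
  obtain ⟨-, t0, bφ0, -, lφ0, -, mT0⟩ := P0
  obtain ⟨-, t1, bφ1, -, lφ1, -, mT1⟩ := P1
  have gb : ∀ T : (Fin d → ℝ) → (Fin d → ℝ), (∀ᵐ x ∂(volume.restrict U), ‖T x‖ ≤ R) →
      ∀ᵐ x ∂(volume.restrict U), |-gp p (x i - T x i)| ≤ G := by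
    intro T hT
    filter_upwards [hT, ae_restrict_mem Um] with x hx hxU
    rw [abs_neg]
    refine gp_bound hp (by linarith) ((abs_sub _ _).trans ?_)
    have := coord_le (hU x hxU) i
    have := coord_le hx i
    linarith
  have mq : ∀ T : (Fin d → ℝ) → (Fin d → ℝ), Measurable T →
      Measurable (fun x => -gp p (x i - T x i)) := by
    intro T hT
    have h1 : Measurable (fun x : Fin d → ℝ => x i - T x i) := by fun_prop
    exact ((gp_meas p).comp h1).neg
  have nv : ‖(Pi.single i r : Fin d → ℝ)‖ = r := by
    rw [Pi.norm_single, Real.norm_of_nonneg r0.le]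
  set ρ := r ^ (min p 2 - 1) with hρ
  have ρ0 : 0 ≤ ρ := Real.rpow_nonneg r0.le _
  have est := dq_est Um Uf hC2' (meas_of_lip K0 lφ0) (meas_of_lip K0 lφ1) (mq T0 mT0) (mq T1 mT1)
    (a := a) lφ0 lφ1 K0 bφ0 bφ1 (gb T0 (t0.mono fun x h => h.1)) (gb T1 (t1.mono fun x h => h.1)) G0
    (mul_nonneg hC1 ρ0) r0 (Pi.single i r) nv d0 d1
  have eL : ∫ x in U, (-gp p (x i - T0 x i) - -gp p (x i - T1 x i)) ^ 2 =
      ∫ x in U, (gp p (x i - T0 x i) - gp p (x i - T1 x i)) ^ 2 := by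
    congr 1; ext x; ring
  rw [eL] at est
  refine est.trans ?_
  have eρ : w ^ (2 * (min p 2 - 1) ^ 2 / (min p 2 * (min p 2 + 1))) = ρ := by
    rw [hρ, hr, ← Real.rpow_mul w0.le]; congr 1; ring
  rw [eρ]
  have rρ : r ≤ ρ := by
    rw [hρ]
    calc r = r ^ (1 : ℝ) := (Real.rpow_one r).symm
      _ ≤ r ^ (min p 2 - 1) := Real.rpow_le_rpow_of_exponent_ge r0 r1 (by linarith)
  have eδ : w ^ (2 * (min p 2 - 1) / min p 2) = ρ * r ^ 2 := by
    rw [← Real.rpow_two r, hρ, ← Real.rpow_add r0, hr, ← Real.rpow_mul w0.le]; congr 1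
    have : min p 2 ≠ 0 := by linarith
    have : min p 2 + 1 ≠ 0 := by linarith
    field_simp; ring
  rw [eδ] at ha
  have t4 : 12 * (∫ x in U, (φ1 x - φ0 x - a) ^ 2) / r ^ 2 ≤ 12 * V2 * ρ := by
    rw [div_le_iff₀ (by positivity)]
    nlinarith
  have t1 : 12 * (K + G) * K * C2 * r ≤ 12 * (K + G) * K * C2 * ρ :=
    mul_le_mul_of_nonneg_left rρ (by positivity)
  have t2 : 4 * G ^ 2 * C2 * r ≤ 4 * G ^ 2 * C2 * ρ :=
    mul_le_mul_of_nonneg_left rρ (by positivity)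
  nlinarith

lemma core2 (d : ℕ) {p R : ℝ} (hp : 1 < p) (hR : 1 ≤ R) {U : Set (Fin d → ℝ)} (Um : MeasurableSet U)
    (Uf : volume U ≠ ∞) (hU : ∀ x ∈ U, ‖x‖ ≤ R - 1) {C' : ℝ} (hC' : 0 ≤ C') :
    ∃ C, 0 ≤ C ∧ ∀ T0 T1 : (Fin d → ℝ) → (Fin d → ℝ), Measurable T0 → Measurable T1 →
      (∀ᵐ x ∂(volume.restrict U), ‖T0 x‖ ≤ R) → (∀ᵐ x ∂(volume.restrict U), ‖T1 x‖ ≤ R) →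
      ∀ A, 0 < A → ∀ i, ∫ x in U, (gp p (x i - T0 x i) - gp p (x i - T1 x i)) ^ 2 ≤ C' * A →
      ∫ x in U, (T0 x i - T1 x i) ^ 2 ≤ C * A ^ (min (1 / (p - 1)) 1) := by
  obtain ⟨Ci, hCi, hinv⟩ := gp_inv_holder hp (show 1 ≤ 2 * R by linarith)
  have hfin : IsFiniteMeasure (volume.restrict U) := ⟨by simpa using lt_top_iff_ne_top.2 Uf⟩
  have V0 : 0 ≤ (volume U).toReal := ENNReal.toReal_nonneg
  set b := min (1 / (p - 1)) 1 with hb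
  have p1 : 0 < p - 1 := by linarith
  have b0 : 0 < b := lt_min (by positivity) one_pos
  have b1 : b ≤ 1 := min_le_right _ _
  refine ⟨Ci ^ 2 * ((volume U).toReal + C'), by positivity, ?_⟩
  intro T0 T1 mT0 mT1 h0 h1 A hA i hq
  set Q : (Fin d → ℝ) → ℝ := fun x => (gp p (x i - T0 x i) - gp p (x i - T1 x i)) ^ 2 with hQ
  have mq : ∀ T : (Fin d → ℝ) → (Fin d → ℝ), Measurable T →
      Measurable (fun x => gp p (x i - T x i)) := by
    intro T hT
    have h1 : Measurable (fun x : Fin d → ℝ => x i - T x i) := by fun_prop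
    exact ((gp_meas p).comp h1)
  have mQ : Measurable Q := ((mq T0 mT0).sub (mq T1 mT1)).pow_const 2
  have bd : ∀ T : (Fin d → ℝ) → (Fin d → ℝ), (∀ᵐ x ∂(volume.restrict U), ‖T x‖ ≤ R) →
      ∀ᵐ x ∂(volume.restrict U), |x i - T x i| ≤ 2 * R := by
    intro T hT
    filter_upwards [hT, ae_restrict_mem Um] with x hx hxU
    refine (abs_sub _ _).trans ?_
    have := coord_le (hU x hxU) i
    have := coord_le hx i
    linarith
  have iQ : IntegrableOn Q U := by
    refine Integrable.of_bound mQ.aestronglyMeasurable ((2 * (p * (2 * R) ^ (p - 1))) ^ 2) ?_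
    filter_upwards [bd T0 h0, bd T1 h1] with x a0 a1
    rw [Real.norm_of_nonneg (sq_nonneg _)]
    have c0 := abs_le.1 (gp_bound hp (by linarith) a0)
    have c1 := abs_le.1 (gp_bound hp (by linarith) a1)
    exact sq_le_sq' (by linarith) (by linarith)
  have pt : ∀ᵐ x ∂(volume.restrict U), (T0 x i - T1 x i) ^ 2 ≤ Ci ^ 2 * A ^ b + Ci ^ 2 * A ^ (b - 1) * Q x := by
    filter_upwards [bd T0 h0, bd T1 h1] with x a0 a1
    have := hinv _ _ a0 a1
    have e : x i - T0 x i - (x i - T1 x i) = -(T0 x i - T1 x i) := by ring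
    rw [e, abs_neg] at this
    have h2 := pow_le_pow_left₀ (abs_nonneg _) this 2
    rw [sq_abs, mul_pow] at h2
    refine h2.trans ?_
    have e2 : (|gp p (x i - T0 x i) - gp p (x i - T1 x i)| ^ b) ^ 2 = Q x ^ b := by
      rw [← Real.rpow_natCast, ← Real.rpow_mul (abs_nonneg _), mul_comm, Real.rpow_mul (abs_nonneg _),
        Real.rpow_natCast, sq_abs]
    rw [e2]
    have := mul_le_mul_of_nonneg_left (pow_split b0 b1 hA (sq_nonneg _ : 0 ≤ Q x)) (sq_nonneg Ci)
    linarith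
  have iT : IntegrableOn (fun x => (T0 x i - T1 x i) ^ 2) U := by
    refine Integrable.of_bound (Measurable.aestronglyMeasurable (by fun_prop)) ((2 * R) ^ 2) ?_
    filter_upwards [h0, h1] with x a0 a1
    rw [Real.norm_of_nonneg (sq_nonneg _)]
    have c0 := abs_le.1 (coord_le a0 i)
    have c1 := abs_le.1 (coord_le a1 i)
    exact sq_le_sq' (by linarith) (by linarith)
  have j1 : IntegrableOn (fun _ : Fin d → ℝ => Ci ^ 2 * A ^ b) U := integrable_const _
  have j2 : IntegrableOn (fun x => Ci ^ 2 * A ^ (b - 1) * Q x) U := iQ.const_mul _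
  have step := integral_mono_ae iT (j1.add j2) pt
  have E1 := integral_add j1 j2
  simp only [Pi.add_apply] at E1 step
  have CC : ∫ _ in U, Ci ^ 2 * A ^ b = Ci ^ 2 * A ^ b * (volume U).toReal := by
    rw [setIntegral_const, smul_eq_mul, mul_comm]; rfl
  rw [E1, CC, integral_const_mul] at step
  refine step.trans ?_
  have eA : A ^ b = A ^ (b - 1) * A := by rw [← Real.rpow_add_one hA.ne']; congr 1; ring
  have pA : 0 < A ^ (b - 1) := Real.rpow_pos_of_pos hA _
  have := mul_le_mul_of_nonneg_left hq (show 0 ≤ Ci ^ 2 * A ^ (b - 1) by positivity)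
  rw [eA]
  nlinarith

lemma setup {d : ℕ} {lam : Measure (Vec d)} (hlam : IsProbabilityMeasure lam)
    (hn : ∃ S : Set (Vec d), Bornology.IsBounded S ∧ Convex ℝ S ∧
      ∃ (f : Vec d → ℝ≥0∞) (c₁ c₂ : ℝ≥0∞), 0 < c₁ ∧ c₂ < ∞ ∧
        lam = volume.withDensity f ∧ (∀ x ∈ S, c₁ ≤ f x ∧ f x ≤ c₂) ∧ (∀ x ∉ S, f x = 0)) :
    ∃ U : Set (Vec d), MeasurableSet U ∧ Convex ℝ U ∧ Bornology.IsBounded U ∧ volume U ≠ 0 ∧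
      volume U ≠ ∞ ∧ (∃ x0 η, 0 < η ∧ Metric.closedBall x0 η ⊆ U) ∧ lam Uᶜ = 0 ∧
      ∃ c₁ c₂ : ℝ≥0∞, c₁ ≠ 0 ∧ c₁ ≠ ∞ ∧ c₂ ≠ ∞ ∧ c₁ • (volume.restrict U) ≤ lam ∧
        lam ≤ c₂ • (volume.restrict U) := by
  obtain ⟨S, Sb, Sc, f, c1, c2, h1, h2, rfl, hf, hf0⟩ := hn
  have Uo : IsOpen (interior S) := isOpen_interior
  have hfr : volume (frontier S) = 0 := Sc.addHaar_frontier volume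
  have hle : volume.withDensity f ≤ c2 • (volume.restrict (interior S)) := by
    rw [Measure.le_iff]
    intro s hs
    rw [withDensity_apply _ hs, Measure.smul_apply, Measure.restrict_apply hs, smul_eq_mul]
    have hae : ∀ᵐ x ∂(volume.restrict s), f x ≤ (s ∩ interior S).indicator (fun _ => c2) x := by
      have : ∀ᵐ x ∂(volume : Measure (Vec d)), x ∉ frontier S := by
        exact measure_eq_zero_iff_ae_notMem.1 hfr
      filter_upwards [ae_restrict_of_ae this, ae_restrict_mem hs] with x hx hxs
      by_cases hxS : x ∈ interior S
      · rw [Set.indicator_of_mem (show x ∈ s ∩ interior S from ⟨hxs, hxS⟩)]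
        exact (hf x (interior_subset hxS)).2
      · have : x ∉ S := by
          intro hS
          exact hx ⟨subset_closure hS, hxS⟩
        rw [hf0 x this]; exact zero_le
    calc _ ≤ ∫⁻ x in s, (s ∩ interior S).indicator (fun _ => c2) x := lintegral_mono_ae hae
      _ ≤ ∫⁻ x, (s ∩ interior S).indicator (fun _ => c2) x := setLIntegral_le_lintegral _ _
      _ = _ := by
        rw [lintegral_indicator_const (hs.inter Uo.measurableSet)]
  have hge : c1 • (volume.restrict (interior S)) ≤ volume.withDensity f := by
    rw [Measure.le_iff]
    intro s hs
    rw [withDensity_apply _ hs, Measure.smul_apply, Measure.restrict_apply hs, smul_eq_mul]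
    calc _ = ∫⁻ x in s ∩ interior S, c1 := by simp
      _ ≤ ∫⁻ x in s ∩ interior S, f x := by
        apply setLIntegral_mono' (hs.inter Uo.measurableSet)
        intro x hx; exact (hf x (interior_subset hx.2)).1
      _ ≤ _ := lintegral_mono_set Set.inter_subset_left
  have hU0 : volume (interior S) ≠ 0 := by
    intro h0
    have := hle Set.univ
    rw [hlam.measure_univ] at this
    simp [h0] at this
  obtain ⟨x0, hx0⟩ : (interior S).Nonempty := nonempty_of_measure_ne_zero hU0
  have hb : Bornology.IsBounded (interior S) := Sb.subset interior_subset
  refine ⟨interior S, Uo.measurableSet, Sc.interior, hb, hU0, hb.measure_lt_top.ne,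
    ?_, ?_, c1, c2, h1.ne', ?_, h2.ne, hge, hle⟩
  · obtain ⟨η, hη, h⟩ := Metric.nhds_basis_closedBall.mem_iff.1 (Uo.mem_nhds hx0)
    exact ⟨x0, η, hη, h⟩
  · have := hle (interior S)ᶜ
    rw [Measure.smul_apply, Measure.restrict_apply Uo.measurableSet.compl] at this
    simpa using this
  · have := hf x0 (interior_subset hx0)
    exact ((this.1.trans this.2).trans_lt h2).ne

lemma lpDist_nonneg (p : ℝ) {d : ℕ} (x y : Vec d) : 0 ≤ lpDist p x y :=
  Real.rpow_nonneg (Finset.sum_nonneg fun i _ => Real.rpow_nonneg (abs_nonneg _) _) _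

lemma lpDist_pow {p : ℝ} (hp : 1 < p) {d : ℕ} (x y : Vec d) :
    lpDist p x y ^ p = ∑ i, |x i - y i| ^ p := by
  unfold lpDist
  rw [← Real.rpow_mul (Finset.sum_nonneg fun i _ => Real.rpow_nonneg (abs_nonneg _) _),
    one_div, inv_mul_cancel₀ (by linarith), Real.rpow_one]

lemma lpDist_le {p : ℝ} (hp : 1 < p) {d : ℕ} {x y : Vec d} {M : ℝ} (hM : 0 ≤ M) (h : ∀ i, |x i - y i| ≤ M) :
    lpDist p x y ≤ (d : ℝ) ^ (1 / p) * M := by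
  have h1 : lpDist p x y ^ p ≤ ((d : ℝ) ^ (1 / p) * M) ^ p := by
    rw [lpDist_pow hp, Real.mul_rpow (by positivity) hM, ← Real.rpow_mul (by positivity), one_div,
      inv_mul_cancel₀ (by linarith), Real.rpow_one]
    calc _ ≤ ∑ i : Fin d, M ^ p := Finset.sum_le_sum fun i _ =>
          Real.rpow_le_rpow (abs_nonneg _) (h i) (by linarith)
      _ = _ := by simp
  exact (Real.rpow_le_rpow_iff (lpDist_nonneg p x y) (by positivity) (by linarith)).1 h1

lemma dist_le_lpDist {p : ℝ} (hp : 1 < p) {d : ℕ} (x y : Vec d) : dist x y ≤ lpDist p x y := by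
  refine (dist_pi_le_iff (lpDist_nonneg p x y)).2 fun i => ?_
  rw [Real.dist_eq]
  refine (Real.rpow_le_rpow_iff (abs_nonneg _) (lpDist_nonneg p x y) (by linarith : 0 < p)).1 ?_
  rw [lpDist_pow hp]
  exact Finset.single_le_sum (f := fun i => |x i - y i| ^ p)
    (fun i _ => Real.rpow_nonneg (abs_nonneg _) _) (Finset.mem_univ i)

lemma lpDist_meas (p : ℝ) {d : ℕ} : Measurable (fun z : Vec d × Vec d => lpDist p z.1 z.2) := by
  unfold lpDist
  have : ∀ i : Fin d, Measurable (fun z : Vec d × Vec d => |z.1 i - z.2 i| ^ p) := by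
    intro i
    have : Measurable (fun z : Vec d × Vec d => |z.1 i - z.2 i|) := by
      have : Continuous (fun z : Vec d × Vec d => |z.1 i - z.2 i|) := by fun_prop
      exact this.measurable
    exact this.pow_const p
  exact (Finset.measurable_sum _ fun i _ => this i).pow_const _

lemma ae_fst {d : ℕ} {γ : Measure (Vec d × Vec d)} {α β : Measure (Vec d)} (h : IsCoupling γ α β)
    {P : Vec d → Prop} (hP : ∀ᵐ x ∂α, P x) : ∀ᵐ z ∂γ, P z.1 := by
  rw [← h.2.1] at hP
  exact ae_of_ae_map measurable_fst.aemeasurable hP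

lemma ae_snd {d : ℕ} {γ : Measure (Vec d × Vec d)} {α β : Measure (Vec d)} (h : IsCoupling γ α β)
    {P : Vec d → Prop} (hP : ∀ᵐ x ∂β, P x) : ∀ᵐ z ∂γ, P z.2 := by
  rw [← h.2.2] at hP
  exact ae_of_ae_map measurable_snd.aemeasurable hP

lemma opt_transfer {d : ℕ} {p R K : ℝ} (hp : 1 < p) 
    (hcb : ∀ x y : Fin d → ℝ, |cc p R x y| ≤ K)
    (hcL : ∀ x y x' y' : Fin d → ℝ, |cc p R x y - cc p R x' y'| ≤ K * (dist x x' + dist y y'))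
    {lam μ : Measure (Vec d)} [hlam : IsProbabilityMeasure lam]
    (h1 : ∀ᵐ x ∂lam, ‖x‖ ≤ R) (h2 : ∀ᵐ x ∂μ, ‖x‖ ≤ R) {T : Vec d → Vec d}
    (hT : IsOptMap p (lpDist p) lam μ T) {U : Set (Vec d)} (hU : volume.restrict U ≪ lam) :
    ∃ φ ψ, Pot p R K U φ ψ T := by
  obtain ⟨mT, hmap, hW⟩ := hT
  have mg : Measurable (fun x => (x, T x)) := by fun_prop
  set γ := lam.map (fun x => (x, T x)) with hγ
  have pγ : IsProbabilityMeasure γ := Measure.isProbabilityMeasure_map mg.aemeasurable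
  have f1 : γ.map Prod.fst = lam := by
    rw [hγ, Measure.map_map measurable_fst mg]; exact Measure.map_id
  have f2 : γ.map Prod.snd = μ := by
    rw [hγ, Measure.map_map measurable_snd mg]; exact hmap
  have hcγ : IsCoupling γ lam μ := ⟨pγ, f1, f2⟩
  have key : ∀ γ', IsCoupling γ' lam μ → ∫ z, lpDist p z.1 z.2 ^ p ∂γ' = ∫ z, cc p R z.1 z.2 ∂γ' := by
    intro γ' h
    apply integral_congr_ae
    filter_upwards [ae_fst h h1, ae_snd h h2] with z a b
    rw [lpDist_pow hp, cc_eq a b]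
  have i1 : ∫ x, lpDist p x (T x) ^ p ∂lam = ∫ z, lpDist p z.1 z.2 ^ p ∂γ := by
    rw [hγ, integral_map mg.aemeasurable]
    exact ((lpDist_meas p).pow_const p).aestronglyMeasurable
  have hn : ∀ γ' : Measure (Vec d × Vec d), 0 ≤ ∫ z, lpDist p z.1 z.2 ^ p ∂γ' := fun γ' =>
    integral_nonneg fun z => Real.rpow_nonneg (lpDist_nonneg p _ _) _
  obtain ⟨φ, ψ, a1, a2, a3, a4, a5, a6⟩ := exists_potential (cc_meas p R) hcb hcL γ (by
    intro γ' hp' e1 e2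
    have hc' : IsCoupling γ' lam μ := ⟨hp', e1.trans f1, e2.trans f2⟩
    rw [← key γ hcγ, ← key γ' hc', ← i1]
    have : (∫ x, lpDist p x (T x) ^ p ∂lam) ^ (1 / p) ≤ (∫ z, lpDist p z.1 z.2 ^ p ∂γ') ^ (1 / p) := by
      rw [hW]
      refine csInf_le ⟨0, ?_⟩ ⟨γ', hc', rfl⟩
      rintro _ ⟨γ'', -, rfl⟩
      exact Real.rpow_nonneg (hn _) _
    exact (Real.rpow_le_rpow_iff (by rw [i1]; exact hn _) (hn _) (by positivity)).1 this)
  refine ⟨φ, ψ, a1, ?_, a3, a4, a5, a6, mT⟩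
  apply hU.ae_le
  have b1 : ∀ᵐ x ∂lam, ‖T x‖ ≤ R := by
    rw [← hmap] at h2
    exact ae_of_ae_map mT.aemeasurable h2
  have b2 := ae_of_ae_map mg.aemeasurable a2
  filter_upwards [b1, b2] with x u v
  exact ⟨u, v⟩

lemma W1_eq {d : ℕ} (p : ℝ) (μ ν : Measure (Vec d)) :
    Wp 1 (lpDist p) μ ν = sInf ((fun γ : Measure (Vec d × Vec d) => ∫ z, lpDist p z.1 z.2 ∂γ) ''
      {γ | IsCoupling γ μ ν}) := by
  simp [Wp]

lemma prod_coupling {d : ℕ} {μ ν : Measure (Vec d)} [IsProbabilityMeasure μ] [IsProbabilityMeasure ν] :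
    IsCoupling (μ.prod ν) μ ν := by
  refine ⟨inferInstance, ?_, ?_⟩ <;> simp

lemma lpDist_bd {d : ℕ} {p R : ℝ} (hp : 1 < p) (hR : 0 ≤ R) {x y : Vec d} (hx : ‖x‖ ≤ R) (hy : ‖y‖ ≤ R) :
    lpDist p x y ≤ (d : ℝ) ^ (1 / p) * (2 * R) := by
  apply lpDist_le hp (by linarith)
  intro i
  have h1 := coord_le hx i
  have h2 := coord_le hy i
  have := abs_sub (x i) (y i)
  linarith

lemma lpDist_int {d : ℕ} {p R : ℝ} (hp : 1 < p) (hR : 0 ≤ R) {μ ν : Measure (Vec d)}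
    (h1 : ∀ᵐ x ∂μ, ‖x‖ ≤ R) (h2 : ∀ᵐ x ∂ν, ‖x‖ ≤ R) {γ : Measure (Vec d × Vec d)}
    (hγ : IsCoupling γ μ ν) : Integrable (fun z : Vec d × Vec d => lpDist p z.1 z.2) γ := by
  have := hγ.1
  refine Integrable.of_bound (lpDist_meas p).aestronglyMeasurable ((d : ℝ) ^ (1 / p) * (2 * R)) ?_
  filter_upwards [ae_fst hγ h1, ae_snd hγ h2] with z a b
  rw [Real.norm_of_nonneg (lpDist_nonneg _ _ _)]
  exact lpDist_bd hp hR a b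

lemma W1_bounds {d : ℕ} {p R : ℝ} (hp : 1 < p) (hR : 0 ≤ R) {μ ν : Measure (Vec d)}
    [IsProbabilityMeasure μ] [IsProbabilityMeasure ν]
    (h1 : ∀ᵐ x ∂μ, ‖x‖ ≤ R) (h2 : ∀ᵐ x ∂ν, ‖x‖ ≤ R) :
    0 ≤ Wp 1 (lpDist p) μ ν ∧ Wp 1 (lpDist p) μ ν ≤ (d : ℝ) ^ (1 / p) * (2 * R) := by
  rw [W1_eq]
  have hl : ∀ b ∈ ((fun γ : Measure (Vec d × Vec d) => ∫ z, lpDist p z.1 z.2 ∂γ) ''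
      {γ | IsCoupling γ μ ν}), 0 ≤ b := by
    rintro _ ⟨γ, -, rfl⟩
    exact integral_nonneg fun z => lpDist_nonneg _ _ _
  refine ⟨Real.sInf_nonneg hl, ?_⟩
  have hγ := prod_coupling (μ := μ) (ν := ν)
  refine (csInf_le ⟨0, hl⟩ ⟨μ.prod ν, hγ, rfl⟩).trans ?_
  have : ∫ z, lpDist p z.1 z.2 ∂(μ.prod ν) ≤ ∫ z, ((d : ℝ) ^ (1 / p) * (2 * R)) ∂(μ.prod ν) := by
    apply integral_mono_ae (lpDist_int hp hR h1 h2 hγ) (integrable_const _)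
    filter_upwards [ae_fst hγ h1, ae_snd hγ h2] with z a b
    exact lpDist_bd hp hR a b
  simpa using this

lemma kant {d : ℕ} {p R : ℝ} (hp : 1 < p) (hR : 0 ≤ R) {μ ν : Measure (Vec d)}
    [IsProbabilityMeasure μ] [IsProbabilityMeasure ν]
    (h1 : ∀ᵐ x ∂μ, ‖x‖ ≤ R) (h2 : ∀ᵐ x ∂ν, ‖x‖ ≤ R) {δ : Vec d → ℝ} {L B : ℝ} (hL : 0 ≤ L)
    (mδ : Measurable δ) (hδ : ∀ x y, |δ x - δ y| ≤ L * dist x y) (hB : ∀ x, |δ x| ≤ B)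
    {W : ℝ} (hW : Wp 1 (lpDist p) μ ν < W) : ∫ x, δ x ∂μ - ∫ x, δ x ∂ν ≤ L * W := by
  rw [W1_eq] at hW
  obtain ⟨_, ⟨γ, hγ, rfl⟩, hlt⟩ := exists_lt_of_csInf_lt
    (Set.Nonempty.image _ ⟨μ.prod ν, prod_coupling⟩) hW
  have pγ := hγ.1
  have hγ' : IsCoupling γ μ ν := hγ
  have e1 : ∫ x, δ x ∂μ = ∫ z, δ z.1 ∂γ := by
    rw [← hγ'.2.1, integral_map measurable_fst.aemeasurable mδ.aestronglyMeasurable]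
  have e2 : ∫ x, δ x ∂ν = ∫ z, δ z.2 ∂γ := by
    rw [← hγ'.2.2, integral_map measurable_snd.aemeasurable mδ.aestronglyMeasurable]
  have i1 : Integrable (fun z : Vec d × Vec d => δ z.1) γ :=
    Integrable.of_bound (mδ.comp measurable_fst).aestronglyMeasurable B (ae_of_all _ fun z => hB _)
  have i2 : Integrable (fun z : Vec d × Vec d => δ z.2) γ :=
    Integrable.of_bound (mδ.comp measurable_snd).aestronglyMeasurable B (ae_of_all _ fun z => hB _)
  rw [e1, e2, ← integral_sub i1 i2]
  calc _ ≤ ∫ z, L * lpDist p z.1 z.2 ∂γ := by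
        apply integral_mono (i1.sub i2) ((lpDist_int hp hR h1 h2 hγ').const_mul L)
        intro z
        exact (le_abs_self _).trans ((hδ z.1 z.2).trans
          (mul_le_mul_of_nonneg_left (dist_le_lpDist hp _ _) hL))
    _ = L * ∫ z, lpDist p z.1 z.2 ∂γ := integral_const_mul _ _
    _ ≤ L * W := mul_le_mul_of_nonneg_left hlt.le hL

lemma fun_bound {d : ℕ} {p R K : ℝ} (hp : 1 < p) (hR : 0 ≤ R) (hK : 1 ≤ K)
    (hcb : ∀ x y : Fin d → ℝ, |cc p R x y| ≤ K)
    (hcL : ∀ x y x' y' : Fin d → ℝ, |cc p R x y - cc p R x' y'| ≤ K * (dist x x' + dist y y'))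
    {lam μ ν : Measure (Vec d)} [IsProbabilityMeasure lam]
    [IsProbabilityMeasure μ] [IsProbabilityMeasure ν]
    (h1 : ∀ᵐ x ∂μ, ‖x‖ ≤ R) (h2 : ∀ᵐ x ∂ν, ‖x‖ ≤ R) {U : Set (Vec d)} (Uf : volume U ≠ ∞)
    {c₁ : ℝ≥0∞} (hc0 : c₁ ≠ 0) (hc : c₁ ≠ ∞) (hle : c₁ • (volume.restrict U) ≤ lam)
    (hac : lam ≪ volume.restrict U)
    {φ0 ψ0 φ1 ψ1 : Vec d → ℝ} {T0 T1 : Vec d → Vec d} (P0 : Pot p R K U φ0 ψ0 T0)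
    (P1 : Pot p R K U φ1 ψ1 T1) (m0 : lam.map T0 = μ) (m1 : lam.map T1 = ν)
    {W : ℝ} (hW : Wp 1 (lpDist p) μ ν < W) :
    ∫ x in U, (φ0 x + φ1 x - 2 * ctr (cc p R) (fun z => (ψ0 z + ψ1 z) / 2) x) ≤
      c₁.toReal⁻¹ * (K * W) := by
  obtain ⟨a1, a2, a3, a4, a5, a6, a7⟩ := P0
  obtain ⟨b1, b2, b3, b4, b5, b6, b7⟩ := P1
  have K0 : 0 ≤ K := by linarith
  have hfin : IsFiniteMeasure (volume.restrict U) := ⟨by simpa using lt_top_iff_ne_top.2 Uf⟩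
  set ψ := fun z => (ψ0 z + ψ1 z) / 2 with hψ
  have hψb : ∀ z, |ψ z| ≤ 4 * K := by
    intro z
    have := abs_le.1 (a4 z); have := abs_le.1 (b4 z)
    rw [abs_le, hψ]; constructor <;> dsimp only <;> linarith
  set g := ctr (cc p R) ψ with hg
  set δ := fun z => ψ1 z - ψ0 z with hδ
  set F := fun x => φ0 x + φ1 x - 2 * g x with hF
  set H := fun x => (δ (T0 x) - δ (T1 x)) / 2 with hH
  have mφ0 := meas_of_lip K0 a5
  have mφ1 := meas_of_lip K0 b5
  have mψ0 := meas_of_lip K0 a6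
  have mψ1 := meas_of_lip K0 b6
  have mg : Measurable g := meas_of_lip K0 (ctr_lip hcb hcL hψb)
  have mδ : Measurable δ := mψ1.sub mψ0
  have hδb : ∀ z, |δ z| ≤ 8 * K := by
    intro z
    have := abs_le.1 (a4 z); have := abs_le.1 (b4 z)
    rw [abs_le, hδ]; constructor <;> dsimp only <;> linarith
  have hδL : ∀ x y, |δ x - δ y| ≤ (2 * K) * dist x y := by
    intro x y
    have := abs_le.1 (a6 x y); have := abs_le.1 (b6 x y)
    rw [abs_le, hδ]; constructor <;> dsimp only <;> linarith
  have F0 : ∀ x, 0 ≤ F x := by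
    intro x
    have : g x ≤ (φ0 x + φ1 x) / 2 := by
      apply ctr_le
      intro z
      have u := a1 x z
      have v := b1 x z
      rw [cc_comm p R z x, hψ]; dsimp only; linarith
    simp only [hF]; linarith
  have FH : ∀ᵐ x ∂(volume.restrict U), F x ≤ H x := by
    filter_upwards [a2, b2] with x u v
    have u1 := le_ctr hcb hψb (T0 x) x
    have v1 := le_ctr hcb hψb (T1 x) x
    rw [cc_comm] at u1 v1
    have u2 := u.2
    have v2 := v.2
    rw [← hg] at u1 v1
    simp only [hψ] at u1 v1
    simp only [hF, hH, hδ]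
    linarith
  have iδ : ∀ T : Vec d → Vec d, Measurable T → ∀ m : Measure (Vec d), IsFiniteMeasure m →
      Integrable (fun x => δ (T x)) m := fun T hT m _ =>
    Integrable.of_bound (mδ.comp hT).aestronglyMeasurable (8 * K) (ae_of_all _ fun x => hδb _)
  have iH : ∀ m : Measure (Vec d), IsFiniteMeasure m → Integrable H m := fun m hm =>
    ((iδ T0 a7 m hm).sub (iδ T1 b7 m hm)).div_const 2
  have iF : Integrable F (volume.restrict U) := by
    refine (iH _ hfin).mono' ((mφ0.add mφ1).sub (mg.const_mul 2)).aestronglyMeasurable ?_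
    filter_upwards [FH] with x hx
    rw [Real.norm_of_nonneg (F0 x)]; exact hx
  have s1 : ∫ x in U, F x ≤ ∫ x in U, H x := integral_mono_ae iF (iH _ hfin) FH
  have H0 : 0 ≤ᵐ[lam] H := by
    apply hac.ae_le
    filter_upwards [FH] with x hx
    exact (F0 x).trans hx
  have s2 : c₁.toReal * ∫ x in U, H x ≤ ∫ x, H x ∂lam := by
    have := integral_mono_measure hle H0 (iH lam inferInstance)
    rwa [integral_smul_measure, smul_eq_mul] at this
  have s3 : ∫ x, H x ∂lam ≤ K * W := by
    have e : ∫ x, H x ∂lam = (∫ x, δ x ∂μ - ∫ x, δ x ∂ν) / 2 := by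
      rw [← m0, ← m1, integral_map a7.aemeasurable mδ.aestronglyMeasurable,
        integral_map b7.aemeasurable mδ.aestronglyMeasurable, ← integral_sub (iδ T0 a7 lam inferInstance)
        (iδ T1 b7 lam inferInstance), ← integral_div]
    have := kant hp hR h1 h2 (by linarith : 0 ≤ 2 * K) mδ hδL hδb hW
    rw [e]; linarith
  have c0 : 0 < c₁.toReal := ENNReal.toReal_pos hc0 hc
  calc _ ≤ ∫ x in U, H x := s1
    _ ≤ _ := by
      rw [le_inv_mul_iff₀ c0]; exact s2.trans s3

lemma lpDist_sq {d : ℕ} {p : ℝ} (hp : 1 < p) (x y : Vec d) :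
    lpDist p x y ^ 2 ≤ ((d : ℝ) ^ (1 / p)) ^ 2 * ∑ i, (x i - y i) ^ 2 := by
  have hs : 0 ≤ ∑ i, (x i - y i) ^ 2 := Finset.sum_nonneg fun i _ => sq_nonneg _
  have h := lpDist_le (x := x) (y := y) hp (Real.sqrt_nonneg (∑ i, (x i - y i) ^ 2)) (by
    intro i
    apply Real.abs_le_sqrt
    exact Finset.single_le_sum (f := fun i => (x i - y i) ^ 2) (fun i _ => sq_nonneg _) (Finset.mem_univ i))
  calc _ ≤ ((d : ℝ) ^ (1 / p) * √(∑ i, (x i - y i) ^ 2)) ^ 2 :=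
        pow_le_pow_left₀ (lpDist_nonneg _ _ _) h 2
    _ = _ := by rw [mul_pow, Real.sq_sqrt hs]

lemma lp_int_bound {d : ℕ} {p R : ℝ} (hp : 1 < p) (hR : 0 ≤ R) {lam : Measure (Vec d)}
    {U : Set (Vec d)} (Uf : volume U ≠ ∞) {c₂ : ℝ≥0∞} (hc : c₂ ≠ ∞)
    (hle : lam ≤ c₂ • (volume.restrict U)) {T0 T1 : Vec d → Vec d} (m0 : Measurable T0)
    (m1 : Measurable T1) (h0 : ∀ᵐ x ∂(volume.restrict U), ‖T0 x‖ ≤ R)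
    (h1 : ∀ᵐ x ∂(volume.restrict U), ‖T1 x‖ ≤ R) {B : ℝ}
    (hB : ∀ i, ∫ x in U, (T0 x i - T1 x i) ^ 2 ≤ B) :
    ∫ x, lpDist p (T0 x) (T1 x) ^ 2 ∂lam ≤ c₂.toReal * (((d : ℝ) ^ (1 / p)) ^ 2 * (d * B)) := by
  have hfin : IsFiniteMeasure (volume.restrict U) := ⟨by simpa using lt_top_iff_ne_top.2 Uf⟩
  have mm : Measurable (fun x => (T0 x, T1 x)) := m0.prodMk m1
  have ml : Measurable (fun x => lpDist p (T0 x) (T1 x) ^ 2) := ((lpDist_meas p).comp mm).pow_const 2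
  have il : Integrable (fun x => lpDist p (T0 x) (T1 x) ^ 2) (volume.restrict U) := by
    refine Integrable.of_bound ml.aestronglyMeasurable (((d : ℝ) ^ (1 / p) * (2 * R)) ^ 2) ?_
    filter_upwards [h0, h1] with x a b
    rw [Real.norm_of_nonneg (sq_nonneg _)]
    exact pow_le_pow_left₀ (lpDist_nonneg _ _ _) (lpDist_bd hp hR a b) 2
  have ii : ∀ i, Integrable (fun x => (T0 x i - T1 x i) ^ 2) (volume.restrict U) := by
    intro i
    have : Measurable (fun x => (T0 x i - T1 x i) ^ 2) := by fun_prop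
    refine Integrable.of_bound this.aestronglyMeasurable ((2 * R) ^ 2) ?_
    filter_upwards [h0, h1] with x a b
    rw [Real.norm_of_nonneg (sq_nonneg _), ← sq_abs]
    refine pow_le_pow_left₀ (abs_nonneg _) ?_ 2
    have h1 := coord_le a i
    have h2 := coord_le b i
    have := abs_sub (T0 x i) (T1 x i)
    linarith
  have s1 : ∫ x, lpDist p (T0 x) (T1 x) ^ 2 ∂lam ≤ c₂.toReal * ∫ x in U, lpDist p (T0 x) (T1 x) ^ 2 := by
    have := integral_mono_measure hle (ae_of_all _ fun x => sq_nonneg (lpDist p (T0 x) (T1 x)))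
      (il.smul_measure hc)
    rwa [integral_smul_measure, smul_eq_mul] at this
  refine s1.trans (mul_le_mul_of_nonneg_left ?_ ENNReal.toReal_nonneg)
  calc _ ≤ ∫ x in U, ((d : ℝ) ^ (1 / p)) ^ 2 * ∑ i, (T0 x i - T1 x i) ^ 2 := by
        apply integral_mono il ((integrable_finset_sum _ fun i _ => ii i).const_mul _)
        intro x; exact lpDist_sq hp _ _
    _ = ((d : ℝ) ^ (1 / p)) ^ 2 * ∑ i, ∫ x in U, (T0 x i - T1 x i) ^ 2 := by
        rw [integral_const_mul, integral_finset_sum _ fun i _ => ii i]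
    _ ≤ _ := by
        apply mul_le_mul_of_nonneg_left _ (by positivity)
        calc _ ≤ ∑ i : Fin d, B := Finset.sum_le_sum fun i _ => hB i
          _ = _ := by simp

lemma expo {p θ : ℝ} (hp : 1 < p)
    (hθ : (p < 2 → 0 < θ ∧ θ < (p - 1) ^ 2 / (p * (p + 1))) ∧ (2 ≤ p → θ = 1 / (6 * (p - 1)))) :
    0 < θ ∧ 2 * θ ≤ 2 * (min p 2 - 1) ^ 2 / (min p 2 * (min p 2 + 1)) * min (1 / (p - 1)) 1 := by
  have p1 : 0 < p - 1 := by linarith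
  rcases lt_or_ge p 2 with h | h
  · obtain ⟨h1, h2⟩ := hθ.1 h
    refine ⟨h1, ?_⟩
    rw [min_eq_left h.le, min_eq_right (by rw [le_div_iff₀ p1]; linarith), mul_one, mul_div_assoc]
    linarith
  · rw [hθ.2 h]
    refine ⟨by positivity, ?_⟩
    rw [min_eq_right h, min_eq_left (by rw [div_le_iff₀ p1]; linarith)]
    apply le_of_eq
    field_simp
    norm_num

/-- Hölder stability of optimal transport maps: for λ with bounded convex
support and density bounded above and below, ‖T_μ − T_ν‖_{L²(λ)} ≤ C W₁(μ,ν)^θ for all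
μ, ν supported on a compact set Y. -/
theorem holder_stability_of_OT_maps
    (d : ℕ) (p : ℝ) (hp : 1 < p) (θ : ℝ)
    (hθ : (p < 2 → 0 < θ ∧ θ < (p - 1) ^ 2 / (p * (p + 1))) ∧
          (2 ≤ p → θ = 1 / (6 * (p - 1))))
    (lam : Measure (Vec d)) (hlam : IsProbabilityMeasure lam)
    (hlamnice : ∃ S : Set (Vec d), Bornology.IsBounded S ∧ Convex ℝ S ∧
      ∃ (f : Vec d → ℝ≥0∞) (c₁ c₂ : ℝ≥0∞), 0 < c₁ ∧ c₂ < ∞ ∧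
        lam = volume.withDensity f ∧ (∀ x ∈ S, c₁ ≤ f x ∧ f x ≤ c₂) ∧ (∀ x ∉ S, f x = 0))
    (Y : Set (Vec d)) (hY : IsCompact Y) :
    ∃ C : ℝ, 0 ≤ C ∧
      ∀ μ ν : Measure (Vec d), ProbOn μ Y → ProbOn ν Y →
        ∀ Tμ Tν, IsOptMap p (lpDist p) lam μ Tμ → IsOptMap p (lpDist p) lam ν Tν →
          (∫ x, lpDist p (Tμ x) (Tν x) ^ 2 ∂lam) ^ ((1 : ℝ) / 2) ≤
            C * Wp 1 (lpDist p) μ ν ^ θ := by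
  obtain ⟨U, Um, Uc, Ub, U0, Uf, ⟨x0, η, hη, hball⟩, hlU, c₁, c₂, hc0, hc1, hc2, hge, hle⟩ :=
    setup hlam hlamnice
  obtain ⟨R1, hR1⟩ := Ub.exists_norm_le
  obtain ⟨R2, hR2⟩ := hY.isBounded.exists_norm_le
  set R := max 1 (max (R1 + 1) R2) with hRdef
  have hR : 1 ≤ R := le_max_left _ _
  have hR0 : 0 ≤ R := by linarith
  have hRa : R1 + 1 ≤ R := (le_max_left _ _).trans (le_max_right _ _)
  have hRb : R2 ≤ R := (le_max_right _ _).trans (le_max_right _ _)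
  have hU : ∀ x ∈ U, ‖x‖ ≤ R - 1 := fun x hx => by have := hR1 x hx; linarith
  have hYR : ∀ x ∈ Y, ‖x‖ ≤ R := fun x hx => (hR2 x hx).trans hRb
  obtain ⟨K, hK, hcb, hcL⟩ := cc_consts d hp hR
  have hlR : ∀ᵐ x ∂lam, ‖x‖ ≤ R := by
    have : ∀ᵐ x ∂lam, x ∈ U := by
      rw [ae_iff]; exact hlU
    filter_upwards [this] with x hx
    have := hU x hx; linarith
  have ac1 : volume.restrict U ≪ lam := by
    have h := Measure.absolutelyContinuous_of_le hge
    exact (Measure.absolutelyContinuous_smul hc0).trans h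
  have ac2 : lam ≪ volume.restrict U :=
    (Measure.absolutelyContinuous_of_le hle).trans Measure.smul_absolutelyContinuous
  set D := (d : ℝ) ^ (1 / p) with hD
  have D0 : 0 ≤ D := by positivity
  set M := D * (2 * R) + 1 with hM
  have M1 : 1 ≤ M := by
    have : 0 ≤ D * (2 * R) := by positivity
    linarith
  have M0 : 0 < M := by linarith
  set Λ := c₁.toReal⁻¹ * (K * M) with hΛ
  have K0 : 0 ≤ K := by linarith
  have Λ0 : 0 ≤ Λ := by
    have : 0 ≤ c₁.toReal := ENNReal.toReal_nonneg
    positivity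
  obtain ⟨C1, hC1, H1⟩ := core1 d hp hR Um Uc Uf U0 hU hη hball hK hcb hcL Λ0
  obtain ⟨C2, hC2, H2⟩ := core2 d hp hR Um Uf hU hC1
  obtain ⟨θ0, hθe⟩ := expo hp hθ
  set β := 2 * (min p 2 - 1) ^ 2 / (min p 2 * (min p 2 + 1)) with hβ
  set b := min (1 / (p - 1)) 1 with hb
  set C3 := c₂.toReal * (D ^ 2 * (d * C2)) with hC3
  have C30 : 0 ≤ C3 := by
    have : 0 ≤ c₂.toReal := ENNReal.toReal_nonneg
    positivity
  refine ⟨C3 ^ ((1 : ℝ) / 2) * (M ^ θ)⁻¹, by positivity, ?_⟩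
  intro μ ν hμ hν T0 T1 hT0 hT1
  have pμ := hμ.1
  have pν := hν.1
  have hYae : ∀ m : Measure (Vec d), m Yᶜ = 0 → ∀ᵐ x ∂m, ‖x‖ ≤ R := by
    intro m hm
    have : ∀ᵐ x ∂m, x ∈ Y := by
      rw [ae_iff]; exact hm
    filter_upwards [this] with x hx
    exact hYR x hx
  have hμR := hYae μ hμ.2
  have hνR := hYae ν hν.2
  obtain ⟨φ0, ψ0, P0⟩ := opt_transfer hp hcb hcL hlR hμR hT0 ac1
  obtain ⟨φ1, ψ1, P1⟩ := opt_transfer hp hcb hcL hlR hνR hT1 ac1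
  obtain ⟨W0, WD⟩ := W1_bounds hp hR0 hμR hνR
  set w1 := Wp 1 (lpDist p) μ ν with hw1
  have b0 : ∀ᵐ x ∂(volume.restrict U), ‖T0 x‖ ≤ R := P0.2.1.mono fun x h => h.1
  have b1 : ∀ᵐ x ∂(volume.restrict U), ‖T1 x‖ ≤ R := P1.2.1.mono fun x h => h.1
  have main : ∀ W, w1 < W → W ≤ w1 + 1 →
      (∫ x, lpDist p (T0 x) (T1 x) ^ 2 ∂lam) ^ ((1 : ℝ) / 2) ≤ C3 ^ ((1 : ℝ) / 2) * (M ^ θ)⁻¹ * W ^ θ := by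
    intro W hW hW1
    have Wp0 : 0 < W := by linarith
    have WM : W ≤ M := by linarith
    set w := W / M with hw
    have w0 : 0 < w := by positivity
    have wle : w ≤ 1 := by rw [hw, div_le_one M0]; exact WM
    have s1 := fun_bound hp hR0 hK hcb hcL hμR hνR Uf hc0 hc1 hge ac2 P0 P1 hT0.2.1 hT1.2.1 hW
    have e : c₁.toReal⁻¹ * (K * W) = Λ * w := by
      rw [hΛ, hw]; field_simp
    rw [e] at s1
    have s2 := H1 φ0 ψ0 T0 φ1 ψ1 T1 P0 P1 w w0 wle s1
    have s3 := fun i => H2 T0 T1 hT0.1 hT1.1 b0 b1 (w ^ β) (by positivity) i (s2 i)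
    have s4 := lp_int_bound hp hR0 Uf hc2 hle hT0.1 hT1.1 b0 b1 s3
    have s5 : ∫ x, lpDist p (T0 x) (T1 x) ^ 2 ∂lam ≤ C3 * w ^ (2 * θ) := by
      refine s4.trans ?_
      rw [← Real.rpow_mul w0.le]
      have : w ^ (β * b) ≤ w ^ (2 * θ) := Real.rpow_le_rpow_of_exponent_ge w0 wle hθe
      calc _ = C3 * w ^ (β * b) := by rw [hC3]; ring
        _ ≤ _ := mul_le_mul_of_nonneg_left this C30
    calc _ ≤ (C3 * w ^ (2 * θ)) ^ ((1 : ℝ) / 2) :=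
          Real.rpow_le_rpow (integral_nonneg fun x => sq_nonneg _) s5 (by norm_num)
      _ = C3 ^ ((1 : ℝ) / 2) * w ^ θ := by
          rw [Real.mul_rpow C30 (by positivity), ← Real.rpow_mul w0.le]
          congr 2; ring
      _ = _ := by
          rw [hw, Real.div_rpow Wp0.le M0.le]; field_simp
  have hlim : Filter.Tendsto (fun W : ℝ => C3 ^ ((1 : ℝ) / 2) * (M ^ θ)⁻¹ * W ^ θ) (nhdsWithin w1 (Set.Ioi w1))
      (nhds (C3 ^ ((1 : ℝ) / 2) * (M ^ θ)⁻¹ * w1 ^ θ)) := by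
    have : Continuous (fun W : ℝ => C3 ^ ((1 : ℝ) / 2) * (M ^ θ)⁻¹ * W ^ θ) :=
      continuous_const.mul (Real.continuous_rpow_const θ0.le)
    exact (this.tendsto w1).mono_left nhdsWithin_le_nhds
  refine ge_of_tendsto hlim ?_
  filter_upwards [Ioc_mem_nhdsGT (show w1 < w1 + 1 by linarith)] with W hW
  exact main W hW.1 hW.2

end
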